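/- Suppose Conditions 2.1, 4.1 (with parameter θ₁) and 4.3 (with parameters θ₂, θ₃) are met. Then for every c ∈ (0,1) and every ω ∈ (0, min{ θ₁/(2(1−θ₁)), θ₂/(2(1−θ₂)), θ₃ − 1/2 }), sup_{u ∈ [c/n, 1−c/n]^d} | ĈP_n(u)/g_ω(u) − C̄_n(u)/g_ω(u) | = o_P(1) as n → ∞. -/

import Mathlib

open MeasureTheory Filter Set
open scoped ENNReal NNReal

noncomputable section

namespace BBV

variable {Ω : Type*} [MeasurableSpace Ω] {E : Type*} [MeasurableSpace E] {d : ℕ}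

/-- The real-valued indicator function of a set. -/
def indic {α : Type*} (s : Set α) (x : α) : ℝ := s.indicator (fun _ => (1 : ℝ)) x

/-- `Z n = o_P(r n)`: convergence to zero in (outer) probability at rate `r`. -/
def oP (P : Measure Ω) (Z : ℕ → Ω → ℝ) (r : ℕ → ℝ) : Prop :=
  ∀ ε : ℝ, 0 < ε → Tendsto (fun n => P {ω | ε * r n < |Z n ω|}) atTop (nhds 0)

/-- `Z n = o_P(1)`: convergence to zero in (outer) probability. -/
def oP1 (P : Measure Ω) (Z : ℕ → Ω → ℝ) : Prop := oP P Z fun _ => 1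

/-- `Z n = O_P(1)`: boundedness in (outer) probability. -/
def bigOP (P : Measure Ω) (Z : ℕ → Ω → ℝ) : Prop :=
  ∀ ε : ℝ, 0 < ε → ∃ M : ℝ, ∀ᶠ n in atTop, P {ω | M < |Z n ω|} ≤ ENNReal.ofReal ε

/-- Strict stationarity of a two-sided sequence: all finite-dimensional distributions
are invariant under shifts. -/
def StrictlyStationary (P : Measure Ω) (X : ℤ → Ω → E) : Prop :=
  ∀ (m : ℕ) (idx : Fin m → ℤ) (k : ℤ),
    Measure.map (fun ω (p : Fin m) => X (idx p + k) ω) P =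
      Measure.map (fun ω (p : Fin m) => X (idx p) ω) P

/-- The sigma-field generated by the variables `X i`, `i ∈ S`. -/
def mixSigma (X : ℤ → Ω → E) (S : Set ℤ) : MeasurableSpace Ω :=
  ⨆ i ∈ S, MeasurableSpace.comap (X i) inferInstance

/-- The alpha-mixing coefficient of the sequence `X`. -/
def alphaMix (P : Measure Ω) (X : ℤ → Ω → E) (k : ℕ) : ℝ :=
  sSup {r : ℝ | ∃ (i : ℤ) (A B : Set Ω),
    MeasurableSet[mixSigma X (Set.Iic i)] A ∧
    MeasurableSet[mixSigma X (Set.Ici (i + (k : ℤ)))] B ∧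
    r = |(P (A ∩ B)).toReal - (P A).toReal * (P B).toReal|}

/-- Exponentially decaying alpha-mixing coefficients: `α(k) = O(a^k)` for some `a ∈ (0,1)`. -/
def ExpAlphaMixing (P : Measure Ω) (X : ℤ → Ω → E) : Prop :=
  ∃ a ∈ Set.Ioo (0 : ℝ) 1, ∃ c : ℝ, ∀ k : ℕ, 1 ≤ k → alphaMix P X k ≤ c * a ^ k

/-- Marginal c.d.f. `F_j` of the stationary sequence. -/
def margF (P : Measure Ω) (X : ℤ → Ω → Fin d → ℝ) (j : Fin d) (x : ℝ) : ℝ :=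
  (P {ω | X 0 ω j ≤ x}).toReal

/-- `U_i = (F_1(X_{i1}),…,F_d(X_{id}))`. -/
def Uv (P : Measure Ω) (X : ℤ → Ω → Fin d → ℝ) (i : ℤ) (ω : Ω) (j : Fin d) : ℝ :=
  margF P X j (X i ω j)

/-- The copula `C` of the stationary distribution, i.e. the c.d.f. of `U_0`. -/
def cop (P : Measure Ω) (X : ℤ → Ω → Fin d → ℝ) (u : Fin d → ℝ) : ℝ :=
  (P {ω | ∀ j, Uv P X 0 ω j ≤ u j}).toReal

/-- Empirical c.d.f. `G_n` of the (unobservable) sample `U_1,…,U_n`. -/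
def Gn (P : Measure Ω) (X : ℤ → Ω → Fin d → ℝ) (n : ℕ) (u : Fin d → ℝ) (ω : Ω) : ℝ :=
  (n : ℝ)⁻¹ * ∑ i ∈ Finset.Icc (1 : ℤ) (n : ℤ), indic {ω' | ∀ j, Uv P X i ω' j ≤ u j} ω

/-- The empirical process `α_n = √n (G_n − C)`. -/
def alphan (P : Measure Ω) (X : ℤ → Ω → Fin d → ℝ) (n : ℕ) (u : Fin d → ℝ) (ω : Ω) : ℝ :=
  Real.sqrt n * (Gn P X n u ω - cop P X u)

/-- Marginal empirical c.d.f. `G_{nj}` based on `U_{1j},…,U_{nj}`. -/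
def Gnj (P : Measure Ω) (X : ℤ → Ω → Fin d → ℝ) (n : ℕ) (j : Fin d) (s : ℝ) (ω : Ω) : ℝ :=
  (n : ℝ)⁻¹ * ∑ i ∈ Finset.Icc (1 : ℤ) (n : ℤ), indic {ω' | Uv P X i ω' j ≤ s} ω

/-- The marginal empirical process `α_{nj}(s) = √n (G_{nj}(s) − s)`. -/
def alphanj (P : Measure Ω) (X : ℤ → Ω → Fin d → ℝ) (n : ℕ) (j : Fin d) (s : ℝ) (ω : Ω) : ℝ :=
  Real.sqrt n * (Gnj P X n j s ω - s)

/-- Left-continuous generalized inverse: `H⁻(s) = inf{x : H(x) ≥ s}` for `s ≠ 0`,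
and `H⁻(0) = sup{x : H(x) = 0}`. -/
def genInv (H : ℝ → ℝ) (s : ℝ) : ℝ :=
  if s = 0 then sSup {x | H x = 0} else sInf {x | s ≤ H x}

/-- The marginal quantile process `β_{nj}(s) = √n (G_{nj}⁻(s) − s)`. -/
def betanj (P : Measure Ω) (X : ℤ → Ω → Fin d → ℝ) (n : ℕ) (j : Fin d) (s : ℝ) (ω : Ω) : ℝ :=
  Real.sqrt n * (genInv (fun x => Gnj P X n j x ω) s - s)

/-- Marginal empirical c.d.f. `F_{nj}` of the observations `X_{1j},…,X_{nj}`. -/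
def empCdfX (X : ℤ → Ω → Fin d → ℝ) (n : ℕ) (j : Fin d) (x : ℝ) (ω : Ω) : ℝ :=
  (n : ℝ)⁻¹ * ∑ i ∈ Finset.Icc (1 : ℤ) (n : ℤ), indic {ω' | X i ω' j ≤ x} ω

/-- Pseudo-observations `Û_{ij} = n/(n+1) · F_{nj}(X_{ij})`. -/
def pseudoObs (X : ℤ → Ω → Fin d → ℝ) (n : ℕ) (i : ℤ) (ω : Ω) (j : Fin d) : ℝ :=
  (n : ℝ) / ((n : ℝ) + 1) * empCdfX X n j (X i ω j) ω

/-- The empirical copula `Ĉ_n`. -/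
def empCop (X : ℤ → Ω → Fin d → ℝ) (n : ℕ) (u : Fin d → ℝ) (ω : Ω) : ℝ :=
  (n : ℝ)⁻¹ * ∑ i ∈ Finset.Icc (1 : ℤ) (n : ℤ), indic {ω' | ∀ j, pseudoObs X n i ω' j ≤ u j} ω

/-- The empirical copula process `ĈP_n = √n (Ĉ_n − C)`. -/
def hatCP (P : Measure Ω) (X : ℤ → Ω → Fin d → ℝ) (n : ℕ) (u : Fin d → ℝ) (ω : Ω) : ℝ :=
  Real.sqrt n * (empCop X n u ω - cop P X u)

/-- First-order partial derivative `Ċ_j` of `C`, defined everywhere as the limsup of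
difference quotients (which coincides with the partial derivative wherever it exists). -/
def Cdot (C : (Fin d → ℝ) → ℝ) (j : Fin d) (u : Fin d → ℝ) : ℝ :=
  Filter.limsup (fun h : ℝ => (C (Function.update u j (u j + h)) - C u) / h)
    (nhdsWithin 0 {(0 : ℝ)}ᶜ)

/-- The process `C̄_n(u) = α_n(u) − Σ_j Ċ_j(u) α_n(u^{(j)})`. -/
def Cbar (P : Measure Ω) (X : ℤ → Ω → Fin d → ℝ) (n : ℕ) (u : Fin d → ℝ) (ω : Ω) : ℝ :=
  alphan P X n u ω -
    ∑ j, Cdot (cop P X) j u * alphan P X n (Function.update (fun _ => (1 : ℝ)) j (u j)) ω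

/-- `C_n(u) = G_n(G_{n1}⁻(u₁),…,G_{nd}⁻(u_d))`. -/
def copGI (P : Measure Ω) (X : ℤ → Ω → Fin d → ℝ) (n : ℕ) (u : Fin d → ℝ) (ω : Ω) : ℝ :=
  Gn P X n (fun j => genInv (fun x => Gnj P X n j x ω) (u j)) ω

/-- The empirical copula process `𝔺_n = √n (C_n − C)` based on generalized inverses. -/
def CPgi (P : Measure Ω) (X : ℤ → Ω → Fin d → ℝ) (n : ℕ) (u : Fin d → ℝ) (ω : Ω) : ℝ :=
  Real.sqrt n * (copGI P X n u ω - cop P X u)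

/-- `g₁(u) = min{ min_j u_j , min_j [1 − min_{k ≠ j} u_k] }`. -/
def g1 (u : Fin d → ℝ) : ℝ :=
  min (⨅ j, u j) (⨅ j : Fin d, (1 - ⨅ k : {k : Fin d // k ≠ j}, u (k : Fin d)))

/-- The weight function `g_ω(u) = g₁(u)^ω`. -/
def gW (w : ℝ) (u : Fin d → ℝ) : ℝ := g1 u ^ w

/-- `g̃_ω(u) = g_ω(u) + 1{g_ω(u) = 0}`. -/
def gTilde (w : ℝ) (u : Fin d → ℝ) : ℝ := if gW w u = 0 then 1 else gW w u

/-- `N(a,b) = {u ∈ [0,1]^d : a < g₁(u) ≤ b}`. -/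
def NN (d : ℕ) (a b : ℝ) : Set (Fin d → ℝ) :=
  {u | (∀ j, 0 ≤ u j ∧ u j ≤ 1) ∧ a < g1 u ∧ g1 u ≤ b}

/-- `V_j = {u ∈ [0,1]^d : u_j ∈ (0,1)}`. -/
def VV (d : ℕ) (j : Fin d) : Set (Fin d → ℝ) :=
  {u | (∀ k, 0 ≤ u k ∧ u k ≤ 1) ∧ 0 < u j ∧ u j < 1}

/-- Condition 2.1: existence, continuity and growth bounds for the first and second
order partial derivatives of the copula `C`. -/
def Condition21 (C : (Fin d → ℝ) → ℝ) : Prop :=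
  (∀ j : Fin d, ∀ u ∈ VV d j,
    HasDerivAt (fun t => C (Function.update u j t)) (Cdot C j u) (u j)) ∧
  (∀ j : Fin d, ContinuousOn (Cdot C j) (VV d j)) ∧
  ∃ Cdd : Fin d → Fin d → (Fin d → ℝ) → ℝ,
    (∀ j₁ j₂ : Fin d, ∀ u ∈ VV d j₁ ∩ VV d j₂,
      HasDerivAt (fun t => Cdot C j₂ (Function.update u j₁ t)) (Cdd j₁ j₂ u) (u j₁)) ∧
    (∀ j₁ j₂ : Fin d, ContinuousOn (Cdd j₁ j₂) (VV d j₁ ∩ VV d j₂)) ∧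
    ∃ K : ℝ, 0 < K ∧ ∀ j₁ j₂ : Fin d, ∀ u ∈ VV d j₁ ∩ VV d j₂,
      |Cdd j₁ j₂ u| ≤ K * min (1 / (u j₁ * (1 - u j₁))) (1 / (u j₂ * (1 - u j₂)))

/-- The weighted modulus of continuity `M_n(δ,μ)` of the empirical process. -/
def Mn (P : Measure Ω) (X : ℤ → Ω → Fin d → ℝ) (n : ℕ) (δ μ : ℝ) (ω : Ω) : ℝ :=
  ⨆ q ∈ {q : (Fin d → ℝ) × (Fin d → ℝ) |
      q.1 ∈ Set.Icc 0 1 ∧ q.2 ∈ Set.Icc 0 1 ∧ dist q.1 q.2 ≤ δ},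
    |alphan P X n q.1 ω - alphan P X n q.2 ω| / max (dist q.1 q.2 ^ μ) ((n : ℝ) ^ (-μ))

/-- Condition 4.1 with parameter `θ₁`. -/
def Condition41 (P : Measure Ω) (X : ℤ → Ω → Fin d → ℝ) (θ₁ : ℝ) : Prop :=
  ∀ μ ∈ Set.Ioo (0 : ℝ) θ₁, ∀ δ : ℕ → ℝ, Tendsto δ atTop (nhds 0) →
    oP1 P (fun n ω => Mn P X n (δ n) μ ω)

/-- Condition 4.3 with parameters `θ₂, θ₃`. -/
def Condition43 (P : Measure Ω) (X : ℤ → Ω → Fin d → ℝ) (θ₂ θ₃ : ℝ) : Prop :=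
  ∀ w ∈ Set.Ioo (0 : ℝ) θ₂, ∀ lam ∈ Set.Ioo (0 : ℝ) θ₃, ∀ j : Fin d,
    bigOP P (fun n ω => ⨆ s ∈ Set.Ioo (0 : ℝ) 1,
      |alphanj P X n j s ω| / (s * (1 - s)) ^ w) ∧
    bigOP P (fun n ω => ⨆ s ∈ Set.Ioo ((n : ℝ) ^ (-lam)) (1 - (n : ℝ) ^ (-lam)),
      |betanj P X n j s ω| / (s * (1 - s)) ^ w)

/-- Properties of a copula on the unit cube: monotone and `1`-Lipschitz in each coordinate,
grounded, with uniform margins. -/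
structure IsCopula (C : (Fin d → ℝ) → ℝ) : Prop where
  increment : ∀ p ∈ Icc (0 : Fin d → ℝ) 1, ∀ j, ∀ s t : ℝ, 0 ≤ s → s ≤ t → t ≤ 1 →
    0 ≤ C (Function.update p j t) - C (Function.update p j s) ∧
      C (Function.update p j t) - C (Function.update p j s) ≤ t - s
  grounded : ∀ p ∈ Icc (0 : Fin d → ℝ) 1, ∀ j, p j = 0 → C p = 0
  margin : ∀ j, ∀ t ∈ Icc (0 : ℝ) 1, C (Function.update (fun _ => (1 : ℝ)) j t) = t

/-- Moving from `u` to `v` one coordinate at a time: errors of the single moves add up. -/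
lemma abs_sub_sub_sum_le_of_coord (f : (Fin d → ℝ) → ℝ) (u v : Fin d → ℝ) (e E : Fin d → ℝ)
    (h : ∀ p : Fin d → ℝ, (∀ k, p k = u k ∨ p k = v k) → ∀ j,
      |f (Function.update p j (v j)) - f (Function.update p j (u j)) - e j| ≤ E j) :
    |f v - f u - ∑ j, e j| ≤ ∑ j, E j := by
  have key : ∀ s : Finset (Fin d),
      |f (s.piecewise v u) - f u - ∑ j ∈ s, e j| ≤ ∑ j ∈ s, E j := by
    intro s
    induction s using Finset.induction_on with
    | empty => simp
    | insert j s hj ih =>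
      have h1 := h (s.piecewise v u) (fun k => by
        by_cases hk : k ∈ s <;> simp [hk]) j
      have h2 : Function.update (s.piecewise v u) j (u j) = s.piecewise v u := by
        conv_rhs => rw [← Function.update_eq_self j (s.piecewise v u)]
        simp [hj]
      rw [h2] at h1
      rw [Finset.piecewise_insert, Finset.sum_insert hj, Finset.sum_insert hj]
      rw [abs_le] at *
      constructor <;> linarith [h1.1, h1.2, ih.1, ih.2]
  simpa using key Finset.univ

/-- Mean value inequality on an unordered interval, for the deviation from slope `e`. -/
lemma abs_sub_sub_mul_le_of_hasDerivAt {f f' : ℝ → ℝ} {a b e D : ℝ}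
    (hf : ContinuousOn f (uIcc a b))
    (hd : ∀ t ∈ Ioo (min a b) (max a b), HasDerivAt f (f' t) t)
    (hD : ∀ t ∈ Ioo (min a b) (max a b), |f' t - e| ≤ D) :
    |f b - f a - e * (b - a)| ≤ D * |b - a| := by
  wlog hab : a ≤ b generalizing a b
  · have := this (a := b) (b := a) (by rwa [uIcc_comm]) (by rwa [min_comm, max_comm])
      (by rwa [min_comm, max_comm]) (le_of_not_ge hab)
    rw [abs_sub_comm b a]
    convert this using 1
    rw [← abs_neg]
    congr 1
    ring
  rcases hab.eq_or_lt with rfl | hlt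
  · simp
  rw [min_eq_left hab, max_eq_right hab] at hd hD
  rw [uIcc_of_le hab] at hf
  obtain ⟨c, hc, hcs⟩ := exists_hasDerivAt_eq_slope f f' hlt hf hd
  have hne : b - a ≠ 0 := (sub_pos.2 hlt).ne'
  have : f b - f a - e * (b - a) = (f' c - e) * (b - a) := by
    rw [hcs]; field_simp
  rw [this, abs_mul]
  exact mul_le_mul_of_nonneg_right (hD c hc) (abs_nonneg _)

lemma update_mem_cube {p : Fin d → ℝ} (hp : p ∈ Icc (0 : Fin d → ℝ) 1) {t : ℝ}
    (ht : t ∈ Icc (0 : ℝ) 1) (j : Fin d) : Function.update p j t ∈ Icc (0 : Fin d → ℝ) 1 := by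
  constructor <;> intro k
  · by_cases h : k = j
    · subst h; simpa using ht.1
    · simpa [h] using hp.1 k
  · by_cases h : k = j
    · subst h; simpa using ht.2
    · simpa [h] using hp.2 k

lemma mem_VV_of_mem_cube {p : Fin d → ℝ} (hp : p ∈ Icc (0 : Fin d → ℝ) 1) {j : Fin d}
    (hj : p j ∈ Ioo (0 : ℝ) 1) : p ∈ VV d j :=
  ⟨fun k => ⟨hp.1 k, hp.2 k⟩, hj.1, hj.2⟩

lemma mem_cube_of_mem_VV {p : Fin d → ℝ} {j : Fin d} (hp : p ∈ VV d j) :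
    p ∈ Icc (0 : Fin d → ℝ) 1 :=
  ⟨fun k => (hp.1 k).1, fun k => (hp.1 k).2⟩

lemma mem_Ioo_of_mem_Ioo_min_max {a b t : ℝ} (ha : a ∈ Icc (0 : ℝ) 1) (hb : b ∈ Icc (0 : ℝ) 1)
    (ht : t ∈ Ioo (min a b) (max a b)) : t ∈ Ioo (0 : ℝ) 1 :=
  ⟨(le_min ha.1 hb.1).trans_lt ht.1, ht.2.trans_le (max_le ha.2 hb.2)⟩

/-- The parabola `t (1 - t)` is concave. -/
lemma le_mul_one_sub_of_mem_uIcc {a b m t : ℝ} (ha : m ≤ a * (1 - a)) (hb : m ≤ b * (1 - b))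
    (ht : t ∈ uIcc a b) : m ≤ t * (1 - t) := by
  wlog hab : a ≤ b generalizing a b
  · exact this hb ha (by rwa [uIcc_comm]) (le_of_not_ge hab)
  rw [uIcc_of_le hab] at ht
  rcases le_total t (1 - a) with h | h <;> nlinarith [ht.1, ht.2]

lemma IsCopula.abs_sub_le {C : (Fin d → ℝ) → ℝ} (hC : IsCopula C) {p : Fin d → ℝ}
    (hp : p ∈ Icc (0 : Fin d → ℝ) 1) (j : Fin d) {s t : ℝ} (hs : s ∈ Icc (0 : ℝ) 1)
    (ht : t ∈ Icc (0 : ℝ) 1) :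
    |C (Function.update p j t) - C (Function.update p j s)| ≤ |t - s| := by
  rcases le_total s t with h | h
  · have := hC.increment p hp j s t hs.1 h ht.2
    rw [abs_of_nonneg this.1, abs_of_nonneg (by linarith)]
    exact this.2
  · have := hC.increment p hp j t s ht.1 h hs.2
    rw [abs_sub_comm, abs_sub_comm t, abs_of_nonneg this.1, abs_of_nonneg (by linarith)]
    exact this.2

lemma IsCopula.continuousOn {C : (Fin d → ℝ) → ℝ} (hC : IsCopula C) {p : Fin d → ℝ}
    (hp : p ∈ Icc (0 : Fin d → ℝ) 1) (j : Fin d) :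
    ContinuousOn (fun t => C (Function.update p j t)) (Icc 0 1) := by
  have : LipschitzOnWith 1 (fun t => C (Function.update p j t)) (Icc 0 1) := by
    refine LipschitzOnWith.of_dist_le_mul fun x hx y hy => ?_
    simpa [Real.dist_eq] using hC.abs_sub_le hp j hy hx
  exact this.continuousOn

lemma Cdot_mem_Icc {C : (Fin d → ℝ) → ℝ} (hC : IsCopula C) (h21 : Condition21 C) {j : Fin d}
    {u : Fin d → ℝ} (hu : u ∈ VV d j) : Cdot C j u ∈ Icc (0 : ℝ) 1 := by
  have hd := (hasDerivAt_iff_tendsto_slope.1 (h21.1 j u hu))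
  have hp := mem_cube_of_mem_VV hu
  have hnb : ∀ᶠ t in nhdsWithin (u j) {u j}ᶜ, t ∈ Ioo (0 : ℝ) 1 :=
    nhdsWithin_le_nhds (Ioo_mem_nhds hu.2.1 hu.2.2)
  have key : ∀ᶠ t in nhdsWithin (u j) {u j}ᶜ,
      slope (fun t => C (Function.update u j t)) (u j) t ∈ Icc (0 : ℝ) 1 := by
    filter_upwards [hnb, self_mem_nhdsWithin] with t ht hne
    have hne : t ≠ u j := hne
    rw [slope_def_field]
    rcases lt_or_gt_of_ne hne with h | h
    · have := hC.increment u hp j t (u j) ht.1.le h.le hu.2.2.le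
      rw [← neg_div_neg_eq, neg_sub, neg_sub]
      exact ⟨div_nonneg this.1 (by linarith), (div_le_one (by linarith)).2 this.2⟩
    · have := hC.increment u hp j (u j) t hu.2.1.le h.le ht.2.le
      exact ⟨div_nonneg this.1 (by linarith), (div_le_one (by linarith)).2 this.2⟩
  exact isClosed_Icc.mem_of_tendsto hd key

/-- The second-order part of Condition 2.1, with constant `K`, gives a Lipschitz bound
for the first-order partial derivatives. -/
lemma exists_Cdot_lipschitz {C : (Fin d → ℝ) → ℝ} (h21 : Condition21 C) :
    ∃ K : ℝ, 0 < K ∧ ∀ j : Fin d, ∀ p ∈ VV d j, ∀ q ∈ VV d j, ∀ m : ℝ,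
      m ≤ p j * (1 - p j) → m ≤ q j * (1 - q j) →
      m * |Cdot C j p - Cdot C j q| ≤ K * ∑ k, |p k - q k| := by
  obtain ⟨-, hcont, Cdd, hdd, -, K, hK, hbd⟩ := h21
  refine ⟨K, hK, fun j p hp q hq m hmp hmq => ?_⟩
  rcases le_or_gt m 0 with hm | hm
  · have h1 : m * |Cdot C j p - Cdot C j q| ≤ 0 :=
      mul_nonpos_of_nonpos_of_nonneg hm (abs_nonneg _)
    exact h1.trans (by positivity)
  have hpc := mem_cube_of_mem_VV hp
  have hqc := mem_cube_of_mem_VV hq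
  have main := abs_sub_sub_sum_le_of_coord (Cdot C j) q p 0 (fun k => K / m * |p k - q k|) ?_
  · simp only [Pi.zero_apply, Finset.sum_const_zero, sub_zero] at main
    rw [← Finset.mul_sum] at main
    calc m * |Cdot C j p - Cdot C j q| ≤ m * (K / m * ∑ k, |p k - q k|) := by gcongr
      _ = K * ∑ k, |p k - q k| := by field_simp
  intro r hr k
  have hrc : r ∈ Icc (0 : Fin d → ℝ) 1 := by
    constructor <;> intro i <;> rcases hr i with h | h <;> rw [h]
    exacts [hqc.1 i, hpc.1 i, hqc.2 i, hpc.2 i]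
  have hrj : r j ∈ Ioo (0 : ℝ) 1 ∧ m ≤ r j * (1 - r j) := by
    rcases hr j with h | h <;> rw [h]
    exacts [⟨hq.2, hmq⟩, ⟨hp.2, hmp⟩]
  have hseg : ∀ t ∈ uIcc (q k) (p k), Function.update r k t ∈ VV d j ∧
      m ≤ Function.update r k t j * (1 - Function.update r k t j) := by
    intro t ht
    have ht01 : t ∈ Icc (0 : ℝ) 1 := by
      have : uIcc (q k) (p k) ⊆ Icc 0 1 :=
        uIcc_subset_Icc ⟨hqc.1 k, hqc.2 k⟩ ⟨hpc.1 k, hpc.2 k⟩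
      exact this ht
    by_cases hkj : k = j
    · subst hkj
      have hm' := le_mul_one_sub_of_mem_uIcc hmq hmp ht
      refine ⟨mem_VV_of_mem_cube (update_mem_cube hrc ht01 k) ?_, by simpa using hm'⟩
      simp only [Function.update_self]
      constructor <;> nlinarith [ht01.1, ht01.2]
    · have hu : Function.update r k t j = r j := by simp [Ne.symm hkj]
      rw [hu]
      exact ⟨mem_VV_of_mem_cube (update_mem_cube hrc ht01 k) (by rw [hu]; exact hrj.1), hrj.2⟩
  have := abs_sub_sub_mul_le_of_hasDerivAt (f := fun t => Cdot C j (Function.update r k t))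
    (f' := fun t => Cdd k j (Function.update r k t)) (a := q k) (b := p k) (e := 0) (D := K / m)
    ?_ ?_ ?_
  · simpa using this
  · exact (hcont j).comp (by fun_prop) (fun t ht => (hseg t ht).1)
  · intro t ht
    have ht01 := mem_Ioo_of_mem_Ioo_min_max ⟨hqc.1 k, hqc.2 k⟩ ⟨hpc.1 k, hpc.2 k⟩ ht
    have hs := hseg t ⟨ht.1.le, ht.2.le⟩
    have := hdd k j (Function.update r k t)
      ⟨mem_VV_of_mem_cube (mem_cube_of_mem_VV hs.1) (by simpa using ht01), hs.1⟩
    simpa using this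
  · intro t ht
    have ht01 := mem_Ioo_of_mem_Ioo_min_max ⟨hqc.1 k, hqc.2 k⟩ ⟨hpc.1 k, hpc.2 k⟩ ht
    have hs := hseg t ⟨ht.1.le, ht.2.le⟩
    have := hbd k j (Function.update r k t)
      ⟨mem_VV_of_mem_cube (mem_cube_of_mem_VV hs.1) (by simpa using ht01), hs.1⟩
    rw [sub_zero]
    refine this.trans ?_
    rw [div_eq_mul_one_div K m]
    refine mul_le_mul_of_nonneg_left ((min_le_right _ _).trans ?_) hK.le
    exact one_div_le_one_div_of_le hm hs.2

lemma Cdot_eq_zero {C : (Fin d → ℝ) → ℝ} (hC : IsCopula C) (h21 : Condition21 C) {j k : Fin d}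
    (hjk : k ≠ j) {u : Fin d → ℝ} (hu : u ∈ VV d j) (hk : u k = 0) : Cdot C j u = 0 := by
  refine (h21.1 j u hu).unique ((hasDerivAt_const (u j) (0 : ℝ)).congr_of_eventuallyEq ?_)
  filter_upwards [Ioo_mem_nhds hu.2.1 hu.2.2] with t ht
  exact hC.grounded _ (update_mem_cube (mem_cube_of_mem_VV hu) ⟨ht.1.le, ht.2.le⟩ j) k
    (by simp [hjk, hk])

lemma ones_update_mem_VV (j : Fin d) {t : ℝ} (ht : t ∈ Ioo (0 : ℝ) 1) :
    Function.update (fun _ => (1 : ℝ)) j t ∈ VV d j :=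
  mem_VV_of_mem_cube (update_mem_cube ⟨fun _ => zero_le_one, fun _ => le_rfl⟩
    ⟨ht.1.le, ht.2.le⟩ j) (by simpa using ht)

lemma Cdot_margin {C : (Fin d → ℝ) → ℝ} (hC : IsCopula C) (h21 : Condition21 C) (j : Fin d)
    {t : ℝ} (ht : t ∈ Ioo (0 : ℝ) 1) :
    Cdot C j (Function.update (fun _ => (1 : ℝ)) j t) = 1 := by
  have h := h21.1 j _ (ones_update_mem_VV j ht)
  simp only [Function.update_idem, Function.update_self] at h
  refine h.unique ((hasDerivAt_id t).congr_of_eventuallyEq ?_)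
  filter_upwards [Ioo_mem_nhds ht.1 ht.2] with s hs
  exact hC.margin j s ⟨hs.1.le, hs.2.le⟩

/-- First-order expansion of a copula along coordinate moves, with slopes `e`. -/
lemma IsCopula.abs_expansion_le {C : (Fin d → ℝ) → ℝ} (hC : IsCopula C) (h21 : Condition21 C)
    {u v e D : Fin d → ℝ} (hu : u ∈ Icc (0 : Fin d → ℝ) 1) (hv : v ∈ Icc (0 : Fin d → ℝ) 1)
    (hD : ∀ j, ∀ p ∈ VV d j, (∀ k, p k ∈ uIcc (u k) (v k)) → |Cdot C j p - e j| ≤ D j) :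
    |C v - C u - ∑ j, e j * (v j - u j)| ≤ ∑ j, D j * |v j - u j| := by
  refine abs_sub_sub_sum_le_of_coord C u v _ _ fun p hp j => ?_
  have hpc : p ∈ Icc (0 : Fin d → ℝ) 1 := by
    constructor <;> intro i <;> rcases hp i with h | h <;> rw [h]
    exacts [hu.1 i, hv.1 i, hu.2 i, hv.2 i]
  have hsub : uIcc (u j) (v j) ⊆ Icc 0 1 :=
    uIcc_subset_Icc ⟨hu.1 j, hu.2 j⟩ ⟨hv.1 j, hv.2 j⟩
  have hV : ∀ t ∈ Ioo (min (u j) (v j)) (max (u j) (v j)), Function.update p j t ∈ VV d j := by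
    intro t ht
    have ht01 := mem_Ioo_of_mem_Ioo_min_max ⟨hu.1 j, hu.2 j⟩ ⟨hv.1 j, hv.2 j⟩ ht
    exact mem_VV_of_mem_cube (update_mem_cube hpc ⟨ht01.1.le, ht01.2.le⟩ j) (by simpa using ht01)
  refine abs_sub_sub_mul_le_of_hasDerivAt (f := fun t => C (Function.update p j t))
    (f' := fun t => Cdot C j (Function.update p j t)) ((hC.continuousOn hpc j).mono hsub) ?_ ?_
  · intro t ht
    simpa using h21.1 j _ (hV t ht)
  · intro t ht
    refine hD j _ (hV t ht) fun k => ?_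
    by_cases hkj : k = j
    · subst hkj
      rw [Function.update_self]
      exact ⟨ht.1.le, ht.2.le⟩
    · rw [Function.update_of_ne hkj]
      rcases hp k with h | h <;> rw [h]
      exacts [left_mem_uIcc, right_mem_uIcc]

lemma rpow_two_mul_le {x μ : ℝ} (hx : 0 ≤ x) (hμ1 : μ ≤ 1) :
    (2 * x) ^ μ ≤ 2 * x ^ μ := by
  rw [Real.mul_rpow zero_le_two hx]
  refine mul_le_mul_of_nonneg_right ?_ (Real.rpow_nonneg hx _)
  exact (Real.rpow_le_rpow_of_exponent_le one_le_two hμ1).trans_eq (Real.rpow_one 2)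

lemma mul_rpow_le_of_mul_le {D m L x τ μ : ℝ} (hD1 : D ≤ 1) (hm : 0 ≤ m)
    (hL : 1 ≤ L) (hx : 0 < x) (hτ : 0 ≤ τ) (hτx : τ ≤ x) (hμ0 : 0 < μ) (hμ1 : μ ≤ 1)
    (h : m * D ≤ L * x) : D * (m + τ) ^ μ ≤ 2 * L * x ^ μ := by
  have hxμ : 0 ≤ x ^ μ := Real.rpow_nonneg hx.le _
  rcases le_or_gt m x with hmx | hmx
  · have h1 : (m + τ) ^ μ ≤ 2 * x ^ μ :=
      (Real.rpow_le_rpow (by positivity) (by linarith) hμ0.le).trans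
        (rpow_two_mul_le hx.le hμ1)
    calc D * (m + τ) ^ μ ≤ 1 * (2 * x ^ μ) := by gcongr
      _ ≤ 2 * L * x ^ μ := by nlinarith
  · have hmpos : 0 < m := hx.trans hmx
    have h1 : (m + τ) ^ μ ≤ 2 * m ^ μ :=
      (Real.rpow_le_rpow (by positivity) (by linarith) hμ0.le).trans
        (rpow_two_mul_le hm hμ1)
    have h2 : D ≤ L * (x / m) := by
      rw [← mul_div_assoc, le_div_iff₀ hmpos]; linarith
    have h3 : x / m ≤ (x / m) ^ μ := by
      have := Real.rpow_le_rpow_of_exponent_ge (div_pos hx hmpos)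
        ((div_le_one hmpos).2 hmx.le) hμ1
      simpa using this
    have h4 : (x / m) ^ μ * m ^ μ = x ^ μ := by
      rw [← Real.mul_rpow (by positivity) hm, div_mul_cancel₀ _ hmpos.ne']
    calc D * (m + τ) ^ μ ≤ (L * (x / m) ^ μ) * (2 * m ^ μ) := by
          have : D ≤ L * (x / m) ^ μ := h2.trans (by gcongr)
          gcongr
      _ = 2 * L * ((x / m) ^ μ * m ^ μ) := by ring
      _ = 2 * L * x ^ μ := by rw [h4]

/-- If `v` solves the quantile equation at level `u` up to an error `τ ^ μ`, the deviation
`v - u` has the same weighted order of magnitude as the marginal process. -/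
lemma quantile_deviation_le {μ M τ s u v : ℝ} (hμ0 : 0 < μ) (hμ : μ ≤ 1 / 2) (hM : 1 ≤ M)
    (hτ : 0 < τ) (hs : s * τ ^ (1 - μ) = 1) (hu : u ∈ Icc (0 : ℝ) 1)
    (hv : v ∈ Icc (0 : ℝ) 1) (h : s * |v - u| ≤ M * (v * (1 - v)) ^ μ + 2 * τ ^ μ) :
    s * |v - u| ≤ (M * (4 + 4 * M ^ 2) + 2) *
      (min (u * (1 - u)) (v * (1 - v)) + τ) ^ μ := by
  set a := u * (1 - u) with ha
  set b := v * (1 - v) with hb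
  have ha0 : 0 ≤ a := mul_nonneg hu.1 (by linarith [hu.2])
  have hb0 : 0 ≤ b := mul_nonneg hv.1 (by linarith [hv.2])
  have hτ1 : 0 < τ ^ (1 - μ) := Real.rpow_pos_of_pos hτ _
  have hdev : |v - u| ≤ M * (τ ^ (1 - μ) * b ^ μ) + 2 * τ := by
    have h1 : |v - u| = τ ^ (1 - μ) * (s * |v - u|) := by
      rw [← mul_assoc, mul_comm (τ ^ (1 - μ)) s, hs, one_mul]
    have h2 : τ ^ (1 - μ) * τ ^ μ = τ := by
      rw [← Real.rpow_add hτ]; simp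
    calc |v - u| = τ ^ (1 - μ) * (s * |v - u|) := h1
      _ ≤ τ ^ (1 - μ) * (M * b ^ μ + 2 * τ ^ μ) := by gcongr
      _ = M * (τ ^ (1 - μ) * b ^ μ) + 2 * (τ ^ (1 - μ) * τ ^ μ) := by ring
      _ = _ := by rw [h2]
  have hlip : b - a ≤ |v - u| := by
    rcases le_total 0 (v - u) with h0 | h0
    · rw [abs_of_nonneg h0, ha, hb]; nlinarith [hu.1, hu.2, hv.1, hv.2]
    · rw [abs_of_nonpos h0, ha, hb]; nlinarith [hu.1, hu.2, hv.1, hv.2]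
  have hbm : b ≤ (4 + 4 * M ^ 2) * (min a b + τ) := by
    rcases le_or_gt b a with hba | hab
    · rw [min_eq_right hba]; nlinarith [sq_nonneg M]
    rw [min_eq_left hab.le]
    rcases le_or_gt b (4 * M ^ 2 * τ) with h1 | h1
    · nlinarith [sq_nonneg M]
    have hbpos : 0 < b := by nlinarith [sq_nonneg M]
    have h4 : (1 : ℝ) ≤ 4 * M ^ 2 := by nlinarith
    have h2 : 2 * M ≤ (4 * M ^ 2) ^ (1 - μ) := by
      have : (4 * M ^ 2) ^ (1 / 2 : ℝ) = 2 * M := by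
        rw [← Real.sqrt_eq_rpow, show 4 * M ^ 2 = (2 * M) ^ 2 by ring,
          Real.sqrt_sq (by linarith)]
      rw [← this]
      exact Real.rpow_le_rpow_of_exponent_le h4 (by linarith)
    have h3 : 2 * M * (τ ^ (1 - μ) * b ^ μ) ≤ b := by
      calc 2 * M * (τ ^ (1 - μ) * b ^ μ) ≤ (4 * M ^ 2) ^ (1 - μ) * (τ ^ (1 - μ) * b ^ μ) := by
            gcongr
        _ = (4 * M ^ 2 * τ) ^ (1 - μ) * b ^ μ := by
            rw [Real.mul_rpow (by positivity) hτ.le]; ring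
        _ ≤ b ^ (1 - μ) * b ^ μ := by
            gcongr
            linarith
        _ = b := by rw [← Real.rpow_add hbpos]; simp
    nlinarith [sq_nonneg M]
  have hmin : 0 ≤ min a b := le_min ha0 hb0
  have hbμ : b ^ μ ≤ (4 + 4 * M ^ 2) * (min a b + τ) ^ μ := by
    have hc : (1 : ℝ) ≤ 4 + 4 * M ^ 2 := by nlinarith
    calc b ^ μ ≤ ((4 + 4 * M ^ 2) * (min a b + τ)) ^ μ := Real.rpow_le_rpow hb0 hbm hμ0.le
      _ = (4 + 4 * M ^ 2) ^ μ * (min a b + τ) ^ μ :=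
          Real.mul_rpow (by positivity) (by positivity)
      _ ≤ (4 + 4 * M ^ 2) * (min a b + τ) ^ μ := by
          gcongr
          exact (Real.rpow_le_rpow_of_exponent_le hc (by linarith)).trans_eq (Real.rpow_one _)
  have hτμ : τ ^ μ ≤ (min a b + τ) ^ μ := Real.rpow_le_rpow hτ.le (by linarith) hμ0.le
  calc s * |v - u| ≤ M * b ^ μ + 2 * τ ^ μ := h
    _ ≤ M * ((4 + 4 * M ^ 2) * (min a b + τ) ^ μ) + 2 * (min a b + τ) ^ μ := by gcongr
    _ = _ := by ring

/-- Deterministic regularity of an empirical process path `α`: weighted boundedness of its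
margins, vanishing on the lower boundary, and a modulus of continuity at scales in `[τ, δ]`. -/
structure RegularPath (α : (Fin d → ℝ) → ℝ) (μ M τ δ : ℝ) : Prop where
  weighted : ∀ j, ∀ t ∈ Icc (0 : ℝ) 1,
    |α (Function.update (fun _ => (1 : ℝ)) j t)| ≤ M * (t * (1 - t)) ^ μ
  grounded : ∀ p ∈ Icc (0 : Fin d → ℝ) 1, ∀ j, p j = 0 → α p = 0
  modulus : ∀ p ∈ Icc (0 : Fin d → ℝ) 1, ∀ q ∈ Icc (0 : Fin d → ℝ) 1, ∀ x : ℝ,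
    τ ≤ x → x ≤ δ → dist p q ≤ x → |α p - α q| ≤ x ^ μ

/-- The difference between the empirical copula process, written at the random point `v`,
and its linearization at `u`. -/
def linError (C α : (Fin d → ℝ) → ℝ) (s : ℝ) (u v : Fin d → ℝ) : ℝ :=
  α v + s * (C v - C u) -
    (α u - ∑ j, Cdot C j u * α (Function.update (fun _ => (1 : ℝ)) j (u j)))

lemma mul_one_sub_nonneg {t : ℝ} (ht : t ∈ Icc (0 : ℝ) 1) : 0 ≤ t * (1 - t) :=
  mul_nonneg ht.1 (sub_nonneg.2 ht.2)

/-- `v` solves the marginal quantile equations at `u` approximately, and is close to `u`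
in a weighted sense. -/
structure QuantilePoint (α : (Fin d → ℝ) → ℝ) (μ s τ B : ℝ) (u v : Fin d → ℝ) : Prop where
  mem_left : ∀ j, u j ∈ Ioo (0 : ℝ) 1
  mem_right : v ∈ Icc (0 : Fin d → ℝ) 1
  equation : ∀ j,
    |s * (v j - u j) + α (Function.update (fun _ => (1 : ℝ)) j (v j))| ≤ 2 * τ ^ μ
  deviation : ∀ j, s * |v j - u j| ≤
    B * (min (u j * (1 - u j)) (v j * (1 - v j)) + τ) ^ μ

/-- Master bound for the linearization error, for arbitrary pivot slopes `e`. -/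
lemma abs_linError_le {C α : (Fin d → ℝ) → ℝ} (hC : IsCopula C) (h21 : Condition21 C)
    {μ M s τ δ B L A x : ℝ} (hα : RegularPath α μ M τ δ) (hμ0 : 0 < μ) (hμ1 : μ ≤ 1)
    (hM : 0 ≤ M) (hs : 0 ≤ s) (hτ : 0 < τ) (hB : 0 ≤ B) (hL : 1 ≤ L) (hτx : τ ≤ x)
    {u v e : Fin d → ℝ} (hq : QuantilePoint α μ s τ B u v)
    (he : ∀ j, e j ∈ Icc (0 : ℝ) 1)
    (hD : ∀ j, ∀ p ∈ VV d j, (∀ k, p k ∈ uIcc (u k) (v k)) →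
      min (u j * (1 - u j)) (v j * (1 - v j)) * |Cdot C j p - e j| ≤ L * x)
    (hDu : ∀ j, u j * (1 - u j) * |Cdot C j u - e j| ≤ L * x)
    (hA : |(α v - ∑ j, e j * α (Function.update (fun _ => (1 : ℝ)) j (v j))) -
      (α u - ∑ j, e j * α (Function.update (fun _ => (1 : ℝ)) j (u j)))| ≤ A * x ^ μ) :
    |linError C α s u v| ≤ (d * (2 * L * B) + d * (2 * L * M) + d * 2 + A) * x ^ μ := by
  obtain ⟨hu, hv, hquant, hdev⟩ := hq
  have hx : 0 < x := hτ.trans_le hτx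
  have huc : u ∈ Icc (0 : Fin d → ℝ) 1 := ⟨fun j => (hu j).1.le, fun j => (hu j).2.le⟩
  have huV : ∀ j, u ∈ VV d j := fun j => mem_VV_of_mem_cube huc (hu j)
  have hone : ∀ j, ∀ p ∈ VV d j, |Cdot C j p - e j| ≤ 1 := fun j p hp => by
    have h1 := Cdot_mem_Icc hC h21 hp
    have h2 := he j
    rw [abs_le]; constructor <;> linarith [h1.1, h1.2, h2.1, h2.2]
  have hm : ∀ j, 0 ≤ min (u j * (1 - u j)) (v j * (1 - v j)) := fun j =>
    le_min (mul_one_sub_nonneg ⟨huc.1 j, huc.2 j⟩) (mul_one_sub_nonneg ⟨hv.1 j, hv.2 j⟩)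
  have hexD : ∀ j, ∃ D : ℝ, 0 ≤ D ∧ D ≤ 1 ∧
      min (u j * (1 - u j)) (v j * (1 - v j)) * D ≤ L * x ∧
      ∀ p ∈ VV d j, (∀ k, p k ∈ uIcc (u k) (v k)) → |Cdot C j p - e j| ≤ D := by
    intro j
    rcases (hm j).eq_or_lt with h0 | hpos
    · exact ⟨1, zero_le_one, le_rfl, by rw [← h0]; simp; positivity, fun p hp _ => hone j p hp⟩
    · refine ⟨min 1 (L * x / min (u j * (1 - u j)) (v j * (1 - v j))), by positivity,
        min_le_left _ _, ?_, fun p hp hpu => le_min (hone j p hp) ?_⟩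
      · calc _ ≤ min (u j * (1 - u j)) (v j * (1 - v j)) *
              (L * x / min (u j * (1 - u j)) (v j * (1 - v j))) := by
              gcongr; exact min_le_right _ _
          _ = L * x := by field_simp
      · rw [le_div_iff₀ hpos, mul_comm]; exact hD j p hp hpu
  choose D hD0 hD1 hDm hDp using hexD
  have hxμ : 0 ≤ x ^ μ := Real.rpow_nonneg hx.le _
  have T1 : |s * (C v - C u - ∑ j, e j * (v j - u j))| ≤ d * (2 * L * B) * x ^ μ := by
    have h := hC.abs_expansion_le h21 huc hv hDp
    rw [abs_mul, abs_of_nonneg hs]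
    calc s * |C v - C u - ∑ j, e j * (v j - u j)| ≤ s * ∑ j, D j * |v j - u j| := by gcongr
      _ = ∑ j, D j * (s * |v j - u j|) := by
          rw [Finset.mul_sum]; exact Finset.sum_congr rfl fun j _ => by ring
      _ ≤ ∑ _j : Fin d, B * (2 * L * x ^ μ) := by
          refine Finset.sum_le_sum fun j _ => ?_
          calc D j * (s * |v j - u j|)
              ≤ D j * (B * (min (u j * (1 - u j)) (v j * (1 - v j)) + τ) ^ μ) :=
                mul_le_mul_of_nonneg_left (hdev j) (hD0 j)
            _ = B * (D j * (min (u j * (1 - u j)) (v j * (1 - v j)) + τ) ^ μ) := by ring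
            _ ≤ B * (2 * L * x ^ μ) := by
                exact mul_le_mul_of_nonneg_left
                  (mul_rpow_le_of_mul_le (hD1 j) (hm j) hL hx hτ.le hτx hμ0 hμ1 (hDm j)) hB
      _ = d * (2 * L * B) * x ^ μ := by simp; ring
  have T2 : |∑ j, (Cdot C j u - e j) * α (Function.update (fun _ => (1 : ℝ)) j (u j))| ≤
      d * (2 * L * M) * x ^ μ := by
    refine (Finset.abs_sum_le_sum_abs _ _).trans ?_
    calc ∑ j, |(Cdot C j u - e j) * α (Function.update (fun _ => (1 : ℝ)) j (u j))|
        ≤ ∑ _j : Fin d, M * (2 * L * x ^ μ) := by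
          refine Finset.sum_le_sum fun j _ => ?_
          rw [abs_mul]
          calc _ ≤ |Cdot C j u - e j| * (M * (u j * (1 - u j)) ^ μ) := by
                gcongr; exact hα.weighted j _ ⟨huc.1 j, huc.2 j⟩
            _ = M * (|Cdot C j u - e j| * (u j * (1 - u j) + 0) ^ μ) := by rw [add_zero]; ring
            _ ≤ M * (2 * L * x ^ μ) := by
                exact mul_le_mul_of_nonneg_left (mul_rpow_le_of_mul_le (hone j u (huV j))
                  (mul_one_sub_nonneg ⟨huc.1 j, huc.2 j⟩) hL hx le_rfl hx.le hμ0 hμ1 (hDu j)) hM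
      _ = d * (2 * L * M) * x ^ μ := by simp; ring
  have T3 : |∑ j, e j * (s * (v j - u j) + α (Function.update (fun _ => (1 : ℝ)) j (v j)))| ≤
      d * 2 * x ^ μ := by
    refine (Finset.abs_sum_le_sum_abs _ _).trans ?_
    calc _ ≤ ∑ _j : Fin d, 2 * x ^ μ := by
          refine Finset.sum_le_sum fun j _ => ?_
          rw [abs_mul, abs_of_nonneg (he j).1]
          calc _ ≤ 1 * (2 * τ ^ μ) :=
                mul_le_mul (he j).2 (hquant j) (abs_nonneg _) zero_le_one
            _ ≤ 2 * x ^ μ := by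
                rw [one_mul]; gcongr
      _ = d * 2 * x ^ μ := by simp; ring
  have split : linError C α s u v =
      s * (C v - C u - ∑ j, e j * (v j - u j)) +
      ∑ j, (Cdot C j u - e j) * α (Function.update (fun _ => (1 : ℝ)) j (u j)) +
      ∑ j, e j * (s * (v j - u j) + α (Function.update (fun _ => (1 : ℝ)) j (v j))) +
      ((α v - ∑ j, e j * α (Function.update (fun _ => (1 : ℝ)) j (v j))) -
      (α u - ∑ j, e j * α (Function.update (fun _ => (1 : ℝ)) j (u j)))) := by
    have h1 : ∑ j, (Cdot C j u - e j) * α (Function.update (fun _ => (1 : ℝ)) j (u j)) =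
        ∑ j, Cdot C j u * α (Function.update (fun _ => (1 : ℝ)) j (u j)) -
        ∑ j, e j * α (Function.update (fun _ => (1 : ℝ)) j (u j)) := by
      rw [← Finset.sum_sub_distrib]; exact Finset.sum_congr rfl fun j _ => by ring
    have h2 : ∑ j, e j * (s * (v j - u j) + α (Function.update (fun _ => (1 : ℝ)) j (v j))) =
        s * ∑ j, e j * (v j - u j) +
        ∑ j, e j * α (Function.update (fun _ => (1 : ℝ)) j (v j)) := by
      rw [Finset.mul_sum, ← Finset.sum_add_distrib]
      exact Finset.sum_congr rfl fun j _ => by ring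
    rw [h1, h2, linError]; ring
  rw [split]
  refine (abs_add_le _ _).trans ?_
  have := abs_add_three
    (s * (C v - C u - ∑ j, e j * (v j - u j)))
    (∑ j, (Cdot C j u - e j) * α (Function.update (fun _ => (1 : ℝ)) j (u j)))
    (∑ j, e j * (s * (v j - u j) + α (Function.update (fun _ => (1 : ℝ)) j (v j))))
  linarith

lemma QuantilePoint.mem_cube {α : (Fin d → ℝ) → ℝ} {μ s τ B : ℝ} {u v : Fin d → ℝ}
    (hq : QuantilePoint α μ s τ B u v) : u ∈ Icc (0 : Fin d → ℝ) 1 :=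
  ⟨fun j => (hq.mem_left j).1.le, fun j => (hq.mem_left j).2.le⟩

lemma QuantilePoint.min_nonneg {α : (Fin d → ℝ) → ℝ} {μ s τ B : ℝ} {u v : Fin d → ℝ}
    (hq : QuantilePoint α μ s τ B u v) (j : Fin d) :
    0 ≤ min (u j * (1 - u j)) (v j * (1 - v j)) :=
  le_min (mul_one_sub_nonneg ⟨hq.mem_cube.1 j, hq.mem_cube.2 j⟩)
    (mul_one_sub_nonneg ⟨hq.mem_right.1 j, hq.mem_right.2 j⟩)

lemma QuantilePoint.abs_sub_le_of_mul_le {α : (Fin d → ℝ) → ℝ} {μ s τ B x : ℝ}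
    {u v : Fin d → ℝ} (hq : QuantilePoint α μ s τ B u v) (hμ0 : 0 < μ) (hμ1 : μ ≤ 1)
    (hτ : 0 < τ) (hs : s * τ ^ (1 - μ) = 1) (hB : 0 ≤ B) (hτx : τ ≤ x) {j : Fin d}
    (hj : u j * (1 - u j) ≤ x) : |v j - u j| ≤ 2 * B * x := by
  have hx : 0 < x := hτ.trans_le hτx
  have hm := hq.min_nonneg j
  have h1 : |v j - u j| = τ ^ (1 - μ) * (s * |v j - u j|) := by
    rw [← mul_assoc, mul_comm (τ ^ (1 - μ)) s, hs, one_mul]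
  have hμ : 0 ≤ 1 - μ := sub_nonneg.2 hμ1
  calc |v j - u j| = τ ^ (1 - μ) * (s * |v j - u j|) := h1
    _ ≤ (2 * x) ^ (1 - μ) *
        (B * (min (u j * (1 - u j)) (v j * (1 - v j)) + τ) ^ μ) := by
        have hs0 : 0 ≤ s := by
          by_contra! hneg
          nlinarith [mul_neg_of_neg_of_pos hneg (Real.rpow_pos_of_pos hτ (1 - μ))]
        exact mul_le_mul (Real.rpow_le_rpow hτ.le (by linarith) hμ) (hq.deviation j)
          (by positivity) (by positivity)
    _ ≤ (2 * x) ^ (1 - μ) * (B * (2 * x) ^ μ) := by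
        gcongr
        have := min_le_left (u j * (1 - u j)) (v j * (1 - v j))
        linarith
    _ = B * ((2 * x) ^ (1 - μ) * (2 * x) ^ μ) := by ring
    _ = 2 * B * x := by
        rw [← Real.rpow_add (by positivity)]; simp; ring

lemma QuantilePoint.abs_sub_le {α : (Fin d → ℝ) → ℝ} {μ s τ B : ℝ}
    {u v : Fin d → ℝ} (hq : QuantilePoint α μ s τ B u v) (hμ0 : 0 < μ) (hμ1 : μ ≤ 1)
    (hs : 0 < s) (hτ : 0 < τ) (hτ1 : τ ≤ 1) (hB : 0 ≤ B) (j : Fin d) :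
    |v j - u j| ≤ 2 * B * (1 / s) := by
  have hm := hq.min_nonneg j
  have hu := hq.mem_left j
  have h1 : (min (u j * (1 - u j)) (v j * (1 - v j)) + τ) ^ μ ≤ 2 := by
    have : min (u j * (1 - u j)) (v j * (1 - v j)) + τ ≤ 2 * 1 := by
      have := min_le_left (u j * (1 - u j)) (v j * (1 - v j))
      nlinarith [hu.1, hu.2]
    refine (Real.rpow_le_rpow (by positivity) this hμ0.le).trans ?_
    simpa using rpow_two_mul_le zero_le_one hμ1
  rw [mul_one_div, le_div_iff₀ hs, mul_comm]
  refine (hq.deviation j).trans ?_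
  rw [mul_comm 2 B]
  gcongr

/-- The constant of the linearization bound. -/
def linConst (d : ℕ) (K M B : ℝ) : ℝ :=
  d * (2 * (K * ((d + 1) * (2 * B + 1)) + 1) * B) +
    d * (2 * (K * ((d + 1) * (2 * B + 1)) + 1) * M) + d * 2 + (d + 2) * (2 * B + 1)

/-- Linearization bound when `u` is within `x` of the lower boundary, within `x` of an upper
edge `{u_k = 1, k ≠ j₀}`, or when `x` is the parametric rate `1 / s`. -/
lemma abs_linError_le_of_cases {C α : (Fin d → ℝ) → ℝ} (hC : IsCopula C) (h21 : Condition21 C)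
    {K μ M s τ δ B x : ℝ} (hK : 0 < K)
    (hlip : ∀ j : Fin d, ∀ p ∈ VV d j, ∀ q ∈ VV d j, ∀ m : ℝ,
      m ≤ p j * (1 - p j) → m ≤ q j * (1 - q j) →
      m * |Cdot C j p - Cdot C j q| ≤ K * ∑ k, |p k - q k|)
    (hα : RegularPath α μ M τ δ) (hμ0 : 0 < μ) (hμ1 : μ ≤ 1)
    (hM : 0 ≤ M) (hs : 0 < s) (hτ : 0 < τ) (hτ1 : τ ≤ 1) (hsτ : s * τ ^ (1 - μ) = 1)
    (hB : 0 ≤ B) (hτx : τ ≤ x) (hxδ : (2 * B + 1) * x ≤ δ)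
    {u v : Fin d → ℝ} (hq : QuantilePoint α μ s τ B u v)
    (hcases : (∃ j₁, u j₁ ≤ x) ∨ (∃ j₀, ∀ k, k ≠ j₀ → 1 - u k ≤ x) ∨ x = 1 / s) :
    |linError C α s u v| ≤ linConst d K M B * x ^ μ := by
  have hx : 0 < x := hτ.trans_le hτx
  have hxμ : 0 ≤ x ^ μ := Real.rpow_nonneg hx.le _
  have huc := hq.mem_cube
  have hvc := hq.mem_right
  set b := 2 * B + 1 with hb
  have hb1 : 1 ≤ b := by linarith
  set L := K * ((d + 1) * b) + 1 with hLdef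
  have hd0 : (0 : ℝ) ≤ d := Nat.cast_nonneg d
  have hL : 1 ≤ L := by
    have : 0 ≤ K * ((d + 1) * b) := by positivity
    linarith
  have hbx : x ≤ b * x := by nlinarith
  have hmod : ∀ p ∈ Icc (0 : Fin d → ℝ) 1, ∀ q ∈ Icc (0 : Fin d → ℝ) 1,
      dist p q ≤ b * x → |α p - α q| ≤ b * x ^ μ := by
    intro p hp q hq hpq
    refine (hα.modulus p hp q hq (b * x) (hτx.trans hbx) hxδ hpq).trans ?_
    rw [Real.mul_rpow (by linarith) hx.le]
    gcongr
    exact (Real.rpow_le_rpow_of_exponent_le hb1 hμ1).trans_eq (Real.rpow_one _)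
  have hone : ∀ j, ∀ p ∈ VV d j, |Cdot C j p| ≤ 1 ∧ |Cdot C j p - 1| ≤ 1 := fun j p hp => by
    have h1 := Cdot_mem_Icc hC h21 hp
    constructor <;> rw [abs_le] <;> constructor <;> linarith [h1.1, h1.2]
  have hmin : ∀ j, ∀ p : Fin d → ℝ, (∀ k, p k ∈ uIcc (u k) (v k)) →
      min (u j * (1 - u j)) (v j * (1 - v j)) ≤ p j * (1 - p j) := fun j p hp =>
    le_mul_one_sub_of_mem_uIcc (min_le_left _ _) (min_le_right _ _) (hp j)
  have huV : ∀ j, u ∈ VV d j := fun j => mem_VV_of_mem_cube huc (hq.mem_left j)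
  have hdist : ∀ k, u k * (1 - u k) ≤ x → |v k - u k| ≤ 2 * B * x := fun k hk =>
    hq.abs_sub_le_of_mul_le hμ0 hμ1 hτ hsτ hB hτx hk
  have goal_of : ∀ e : Fin d → ℝ, (∀ j, e j ∈ Icc (0 : ℝ) 1) →
      (∀ j, ∀ p ∈ VV d j, (∀ k, p k ∈ uIcc (u k) (v k)) → ∀ m : ℝ, 0 ≤ m →
        m ≤ p j * (1 - p j) → m ≤ u j * (1 - u j) → m * |Cdot C j p - e j| ≤ L * x) →
      |(α v - ∑ j, e j * α (Function.update (fun _ => (1 : ℝ)) j (v j))) -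
        (α u - ∑ j, e j * α (Function.update (fun _ => (1 : ℝ)) j (u j)))| ≤
          ((d + 2) * b) * x ^ μ →
      |linError C α s u v| ≤ linConst d K M B * x ^ μ := by
    intro e he hD hA
    exact abs_linError_le hC h21 hα hμ0 hμ1 hM hs.le hτ hB hL hτx hq he
      (fun j p hp hpu => hD j p hp hpu _ (hq.min_nonneg j) (hmin j p hpu) (min_le_left _ _))
      (fun j => hD j u (huV j) (fun k => left_mem_uIcc) _
        (mul_one_sub_nonneg ⟨huc.1 j, huc.2 j⟩) le_rfl le_rfl) hA
  have hx_le : x ≤ L * x := by nlinarith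
  rcases hcases with ⟨j₁, hj₁⟩ | ⟨j₀, hj₀⟩ | rfl
  · have hq₁ : u j₁ * (1 - u j₁) ≤ x := by
      nlinarith [(hq.mem_left j₁).1, (hq.mem_left j₁).2]
    have hclose := hdist j₁ hq₁
    have hv₁ : v j₁ ≤ b * x := by
      have := (abs_le.1 hclose).2
      rw [hb]; linarith
    refine goal_of (fun _ => 0) (fun j => ⟨le_rfl, zero_le_one⟩) ?_ ?_
    · intro j p hp hpu m hm hmp hmu
      rw [sub_zero]
      by_cases hj : j = j₁
      · subst hj
        calc m * |Cdot C j p| ≤ m * 1 := by gcongr; exact (hone j p hp).1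
          _ ≤ L * x := by linarith
      · have hpc := mem_cube_of_mem_VV hp
        have hpj : Function.update p j₁ 0 j = p j := by simp [hj]
        have hp0 : Function.update p j₁ 0 ∈ VV d j :=
          mem_VV_of_mem_cube (update_mem_cube hpc ⟨le_rfl, zero_le_one⟩ j₁)
            (by rw [hpj]; exact hp.2)
        have h := hlip j p hp _ hp0 m hmp (by rwa [hpj])
        rw [Cdot_eq_zero hC h21 (Ne.symm hj) hp0 (by simp), sub_zero] at h
        refine h.trans ?_
        have hsum : ∑ k, |p k - Function.update p j₁ 0 k| = p j₁ := by
          rw [Finset.sum_eq_single j₁]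
          · simpa using hpc.1 j₁
          · intro k _ hk; simp [hk]
          · simp
        have hp₁ : p j₁ ≤ b * x := by
          rcases mem_uIcc.1 (hpu j₁) with h | h <;> linarith [h.2]
        rw [hsum]
        have : K * p j₁ ≤ K * (b * x) := by gcongr
        have : 0 ≤ K * (d * (b * x)) := by positivity
        rw [hLdef]; nlinarith
    · have hbd : ∀ w ∈ Icc (0 : Fin d → ℝ) 1, w j₁ ≤ b * x → |α w| ≤ b * x ^ μ := by
        intro w hw hwx
        have h0 := update_mem_cube hw ⟨le_rfl, zero_le_one⟩ j₁
        have h := hmod w hw _ h0 ?_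
        · rwa [hα.grounded _ h0 j₁ (by simp), sub_zero] at h
        · refine (dist_pi_le_iff (by positivity)).2 fun k => ?_
          by_cases hk : k = j₁
          · subst hk
            rw [Function.update_self, Real.dist_eq, sub_zero, abs_of_nonneg (hw.1 k)]
            exact hwx
          · rw [Function.update_of_ne hk, dist_self]; positivity
      have h1 := hbd v hvc hv₁
      have h2 := hbd u huc (hj₁.trans hbx)
      simp only [zero_mul, Finset.sum_const_zero, sub_zero]
      have h3 := abs_sub (α v) (α u)
      have : 0 ≤ d * b * x ^ μ := by positivity
      nlinarith
  · have hq₀ : ∀ k, k ≠ j₀ → u k * (1 - u k) ≤ x := fun k hk => by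
      nlinarith [(hq.mem_left k).1, (hq.mem_left k).2, hj₀ k hk]
    have hv₀ : ∀ k, k ≠ j₀ → 1 - v k ≤ b * x := fun k hk => by
      have := (abs_le.1 (hdist k (hq₀ k hk))).1
      rw [hb]; linarith [hj₀ k hk]
    refine goal_of (fun j => if j = j₀ then 1 else 0)
      (fun j => by split_ifs <;> simp) ?_ ?_
    · intro j p hp hpu m hm hmp hmu
      by_cases hj : j = j₀
      · subst hj
        rw [if_pos rfl]
        have hpc := mem_cube_of_mem_VV hp
        have h := hlip j p hp _ (ones_update_mem_VV j hp.2) m hmp (by simpa using hmp)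
        rw [Cdot_margin hC h21 j hp.2] at h
        refine h.trans ?_
        have hsum : ∑ k, |p k - Function.update (fun _ => (1 : ℝ)) j (p j) k| ≤
            ∑ _k : Fin d, b * x := by
          refine Finset.sum_le_sum fun k _ => ?_
          by_cases hk : k = j
          · subst hk; simp; positivity
          · rw [Function.update_of_ne hk, abs_sub_comm,
              abs_of_nonneg (sub_nonneg.2 (show p k ≤ 1 from hpc.2 k))]
            rcases mem_uIcc.1 (hpu k) with h | h <;> linarith [h.1, hv₀ k hk, hj₀ k hk]
        rw [Finset.sum_const, Finset.card_univ, Fintype.card_fin, nsmul_eq_mul] at hsum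
        have : K * ∑ k, |p k - Function.update (fun _ => (1 : ℝ)) j (p j) k| ≤
            K * (d * (b * x)) := by gcongr
        have : 0 ≤ K * (b * x) := by positivity
        rw [hLdef]; nlinarith
      · rw [if_neg hj, sub_zero]
        calc m * |Cdot C j p| ≤ m * 1 := by gcongr; exact (hone j p hp).1
          _ ≤ L * x := by linarith [hq₀ j hj]
    · have hbd : ∀ w ∈ Icc (0 : Fin d → ℝ) 1, (∀ k, k ≠ j₀ → 1 - w k ≤ b * x) →
          |α w - α (Function.update (fun _ => (1 : ℝ)) j₀ (w j₀))| ≤ b * x ^ μ := by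
        intro w hw hwx
        refine hmod w hw _ (update_mem_cube ⟨fun _ => zero_le_one, fun _ => le_rfl⟩
          ⟨hw.1 j₀, hw.2 j₀⟩ j₀) ?_
        refine (dist_pi_le_iff (by positivity)).2 fun k => ?_
        by_cases hk : k = j₀
        · subst hk
          rw [Function.update_self, dist_self]; positivity
        · rw [Function.update_of_ne hk, Real.dist_eq, abs_sub_comm,
            abs_of_nonneg (sub_nonneg.2 (show w k ≤ 1 from hw.2 k))]
          exact hwx k hk
      have h1 := hbd v hvc hv₀
      have h2 := hbd u huc (fun k hk => (hj₀ k hk).trans hbx)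
      simp only [ite_mul, one_mul, zero_mul, Finset.sum_ite_eq', Finset.mem_univ, if_true]
      have h3 := abs_sub (α v - α (Function.update (fun _ => (1 : ℝ)) j₀ (v j₀)))
        (α u - α (Function.update (fun _ => (1 : ℝ)) j₀ (u j₀)))
      have : 0 ≤ d * b * x ^ μ := by positivity
      nlinarith
  · have hclose : ∀ k, |v k - u k| ≤ b * (1 / s) := fun k => by
      have := hq.abs_sub_le hμ0 hμ1 hs hτ hτ1 hB k
      rw [hb]; linarith
    refine goal_of (fun j => Cdot C j u) (fun j => Cdot_mem_Icc hC h21 (huV j)) ?_ ?_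
    · intro j p hp hpu m hm hmp hmu
      refine (hlip j p hp u (huV j) m hmp hmu).trans ?_
      have hsum : ∑ k, |p k - u k| ≤ ∑ _k : Fin d, b * (1 / s) := by
        refine Finset.sum_le_sum fun k _ => ?_
        have h1 := abs_sub_left_of_mem_uIcc (hpu k)
        exact h1.trans (hclose k)
      rw [Finset.sum_const, Finset.card_univ, Fintype.card_fin, nsmul_eq_mul] at hsum
      have : K * ∑ k, |p k - u k| ≤ K * (d * (b * (1 / s))) := by gcongr
      have : 0 ≤ K * (b * (1 / s)) := by positivity
      rw [hLdef]; nlinarith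
    · have h1 : |α v - α u| ≤ b * (1 / s) ^ μ :=
        hmod v hvc u huc ((dist_pi_le_iff (by positivity)).2 fun k => by
          rw [Real.dist_eq]; exact hclose k)
      have h2 : |∑ j, Cdot C j u * (α (Function.update (fun _ => (1 : ℝ)) j (v j)) -
          α (Function.update (fun _ => (1 : ℝ)) j (u j)))| ≤ d * (b * (1 / s) ^ μ) := by
        refine (Finset.abs_sum_le_sum_abs _ _).trans ?_
        calc _ ≤ ∑ _j : Fin d, b * (1 / s) ^ μ := by
              refine Finset.sum_le_sum fun j _ => ?_
              rw [abs_mul]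
              have hc : ∀ w ∈ Icc (0 : Fin d → ℝ) 1,
                  Function.update (fun _ => (1 : ℝ)) j (w j) ∈ Icc (0 : Fin d → ℝ) 1 :=
                fun w hw => update_mem_cube ⟨fun _ => zero_le_one, fun _ => le_rfl⟩
                  ⟨hw.1 j, hw.2 j⟩ j
              have h := hmod _ (hc v hvc) _ (hc u huc) ?_
              · calc _ ≤ 1 * (b * (1 / s) ^ μ) := by
                      gcongr; exact (hone j u (huV j)).1
                  _ = _ := one_mul _
              · refine (dist_pi_le_iff (by positivity)).2 fun k => ?_
                by_cases hk : k = j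
                · subst hk
                  rw [Function.update_self, Function.update_self, Real.dist_eq]
                  exact hclose k
                · rw [Function.update_of_ne hk, Function.update_of_ne hk, dist_self]
                  positivity
          _ = _ := by simp
      have h3 : (α v - ∑ j, Cdot C j u * α (Function.update (fun _ => (1 : ℝ)) j (v j))) -
          (α u - ∑ j, Cdot C j u * α (Function.update (fun _ => (1 : ℝ)) j (u j))) =
          (α v - α u) - ∑ j, Cdot C j u * (α (Function.update (fun _ => (1 : ℝ)) j (v j)) -
          α (Function.update (fun _ => (1 : ℝ)) j (u j))) := by
        simp only [mul_sub, Finset.sum_sub_distrib]; ring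
      rw [h3]
      refine (abs_sub _ _).trans ?_
      have : 0 ≤ b * (1 / s) ^ μ := by positivity
      nlinarith

/-- Probability integral transform. -/
lemma measureReal_cdf_le (ν : Measure ℝ) [IsProbabilityMeasure ν]
    (hF : Continuous (ProbabilityTheory.cdf ν)) {t : ℝ} (ht : t ∈ Icc (0 : ℝ) 1) :
    ν.real {x | ProbabilityTheory.cdf ν x ≤ t} = t := by
  have hex : ∀ s ∈ Ioo (0 : ℝ) 1, ∃ x, ProbabilityTheory.cdf ν x = s := by
    intro s hs
    obtain ⟨a, ha⟩ := ((ProbabilityTheory.tendsto_cdf_atBot ν).eventually_le_const hs.1).exists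
    obtain ⟨b, hb⟩ := ((ProbabilityTheory.tendsto_cdf_atTop ν).eventually_const_le hs.2).exists
    exact mem_range_of_exists_le_of_exists_ge hF ⟨a, ha⟩ ⟨b, hb⟩
  apply le_antisymm
  · refine le_of_forall_gt_imp_ge_of_dense fun s hs => ?_
    rcases lt_or_ge s 1 with h1 | h1
    · obtain ⟨x, hx⟩ := hex s ⟨ht.1.trans_lt hs, h1⟩
      calc ν.real {x | ProbabilityTheory.cdf ν x ≤ t} ≤ ν.real (Iic x) := by
            refine measureReal_mono fun y hy => ?_
            by_contra hlt
            have := (ProbabilityTheory.cdf ν).mono (le_of_not_ge hlt)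
            rw [hx] at this
            exact absurd (this.trans hy) (not_le.2 hs)
        _ = s := by rw [← ProbabilityTheory.cdf_eq_real, hx]
    · exact measureReal_le_one.trans h1
  · rcases ht.1.eq_or_lt with h0 | h0
    · rw [← h0]; exact measureReal_nonneg
    rcases ht.2.eq_or_lt with h1 | h1
    · subst h1
      simp [ProbabilityTheory.cdf_le_one]
    · obtain ⟨x, hx⟩ := hex t ⟨h0, h1⟩
      calc t = ν.real (Iic x) := by rw [← ProbabilityTheory.cdf_eq_real, hx]
        _ ≤ _ := measureReal_mono fun y hy => by
          simpa [hx] using (ProbabilityTheory.cdf ν).mono hy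

section Transform

variable {P : Measure Ω} {X : ℤ → Ω → Fin d → ℝ}

lemma StrictlyStationary.map_eq (hmeas : ∀ i, Measurable (X i)) (hstat : StrictlyStationary P X)
    (i : ℤ) (j : Fin d) : P.map (fun ω => X i ω j) = P.map (fun ω => X 0 ω j) := by
  have h := congrArg (Measure.map fun x : Fin 1 → Fin d → ℝ => x 0 j) (hstat 1 (fun _ => 0) i)
  rw [Measure.map_map (by fun_prop) (by fun_prop),
    Measure.map_map (by fun_prop) (by fun_prop)] at h
  simpa [Function.comp_def] using h

variable [IsProbabilityMeasure P]

lemma margF_eq_cdf (hmeas : ∀ i, Measurable (X i)) (j : Fin d) :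
    margF P X j = ProbabilityTheory.cdf (P.map fun ω => X 0 ω j) := by
  have hm : Measurable fun ω => X 0 ω j := (measurable_pi_apply j).comp (hmeas 0)
  have := Measure.isProbabilityMeasure_map (μ := P) hm.aemeasurable
  ext x
  rw [ProbabilityTheory.cdf_eq_real, map_measureReal_apply hm measurableSet_Iic]
  rfl

lemma margF_mono (j : Fin d) : Monotone (margF P X j) := fun _ _ h =>
  measureReal_mono fun _ hω => le_trans hω h

lemma Uv_mem_Icc (i : ℤ) (ω : Ω) (j : Fin d) : Uv P X i ω j ∈ Icc (0 : ℝ) 1 :=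
  ⟨measureReal_nonneg, measureReal_le_one⟩

lemma measurable_Uv (hmeas : ∀ i, Measurable (X i)) (i : ℤ) (j : Fin d) :
    Measurable fun ω => Uv P X i ω j :=
  (margF_mono j).measurable.comp ((measurable_pi_apply j).comp (hmeas i))

/-- Each `U_{ij}` is uniformly distributed. -/
lemma measureReal_Uv_le (hmeas : ∀ i, Measurable (X i)) (hstat : StrictlyStationary P X)
    (hcont : ∀ j, Continuous (margF P X j)) (i : ℤ) (j : Fin d) {t : ℝ}
    (ht : t ∈ Icc (0 : ℝ) 1) : P.real {ω | Uv P X i ω j ≤ t} = t := by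
  have hm : Measurable fun ω => X i ω j := (measurable_pi_apply j).comp (hmeas i)
  have := Measure.isProbabilityMeasure_map (μ := P) hm.aemeasurable
  have hF : margF P X j = ProbabilityTheory.cdf (P.map fun ω => X i ω j) := by
    rw [margF_eq_cdf hmeas j, hstat.map_eq hmeas i j]
  have h := measureReal_cdf_le (P.map fun ω => X i ω j) (hF ▸ hcont j) ht
  rw [← hF, map_measureReal_apply hm
    (measurableSet_le (margF_mono j).measurable measurable_const)] at h
  exact h

/-- The sample path is in general position: the `U_{ij}` avoid the endpoints and the
marginal transforms do not identify observations. -/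
structure GoodPath (P : Measure Ω) (X : ℤ → Ω → Fin d → ℝ) (ω : Ω) : Prop where
  mem_Ioo : ∀ i j, Uv P X i ω j ∈ Ioo (0 : ℝ) 1
  le_of_Uv_le : ∀ i k j, Uv P X i ω j ≤ Uv P X k ω j → X i ω j ≤ X k ω j

lemma ae_goodPath (hmeas : ∀ i, Measurable (X i)) (hstat : StrictlyStationary P X)
    (hcont : ∀ j, Continuous (margF P X j)) : ∀ᵐ ω ∂P, GoodPath P X ω := by
  have hU := fun i j (t : ℝ) ht => measureReal_Uv_le hmeas hstat hcont i j (t := t) ht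
  have h0 : ∀ i j, ∀ᵐ ω ∂P, 0 < Uv P X i ω j := fun i j => by
    have h := hU i j 0 ⟨le_rfl, zero_le_one⟩
    rw [measureReal_eq_zero_iff] at h
    rw [ae_iff]
    simpa using h
  have h1 : ∀ i j, ∀ᵐ ω ∂P, Uv P X i ω j < 1 := fun i j => by
    rw [ae_iff, ← measureReal_eq_zero_iff]
    simp only [not_lt]
    refine le_antisymm (le_of_forall_pos_le_add fun ε hε => ?_) measureReal_nonneg
    rcases lt_or_ge ε 1 with hε1 | hε1
    · have h := hU i j (1 - ε) ⟨by linarith, by linarith⟩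
      have hc := probReal_compl_eq_one_sub (μ := P)
        (measurableSet_le (measurable_Uv (P := P) hmeas i j) (measurable_const (a := 1 - ε)))
      rw [h] at hc
      calc P.real {ω | 1 ≤ Uv P X i ω j} ≤ P.real {ω | Uv P X i ω j ≤ 1 - ε}ᶜ := by
            refine measureReal_mono fun ω hω => ?_
            simp only [mem_ofPred_eq, mem_compl_iff, not_le] at hω ⊢
            linarith
        _ = 0 + ε := by rw [hc]; ring
    · exact measureReal_le_one.trans (by linarith)
  have hq : ∀ i j, ∀ q : ℚ, ∀ᵐ ω ∂P, (q : ℝ) < X i ω j → margF P X j q < Uv P X i ω j := by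
    intro i j q
    have hm : ∀ i, Measurable fun ω => X i ω j := fun i =>
      (measurable_pi_apply j).comp (hmeas i)
    have hq1 : margF P X j q ∈ Icc (0 : ℝ) 1 := ⟨measureReal_nonneg, measureReal_le_one⟩
    have h := hU i j _ hq1
    have h' : P.real {ω | X i ω j ≤ q} = margF P X j q := by
      have e := congrArg (fun ν : Measure ℝ => ν.real (Iic (q : ℝ))) (hstat.map_eq hmeas i j)
      rw [map_measureReal_apply (hm i) measurableSet_Iic,
        map_measureReal_apply (hm 0) measurableSet_Iic] at e
      exact e
    rw [ae_iff, ← measureReal_eq_zero_iff]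
    have hd := measureReal_sdiff (μ := P) (s₁ := {ω | Uv P X i ω j ≤ margF P X j q})
      (s₂ := {ω | X i ω j ≤ q}) (fun ω hω => margF_mono j hω)
      (measurableSet_le (hm i) measurable_const)
    rw [h, h', sub_self] at hd
    convert hd using 2
    ext ω
    simp [and_comm]
  filter_upwards [ae_all_iff.2 fun i => ae_all_iff.2 (h0 i),
    ae_all_iff.2 fun i => ae_all_iff.2 (h1 i),
    ae_all_iff.2 fun i => ae_all_iff.2 fun j => ae_all_iff.2 (hq i j)] with ω a b c
  refine ⟨fun i j => ⟨a i j, b i j⟩, fun i k j h => ?_⟩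
  by_contra hlt
  obtain ⟨q, hq1, hq2⟩ := exists_rat_btwn (not_le.1 hlt)
  exact absurd ((c i j q hq2).trans_le h) (not_lt.2 (margF_mono j hq1.le))

lemma isCopula_cop (hmeas : ∀ i, Measurable (X i)) (hstat : StrictlyStationary P X)
    (hcont : ∀ j, Continuous (margF P X j)) : IsCopula (cop P X) := by
  have hU := fun j (t : ℝ) ht => measureReal_Uv_le hmeas hstat hcont 0 j (t := t) ht
  have hms : ∀ p : Fin d → ℝ, MeasurableSet {ω | ∀ j, Uv P X 0 ω j ≤ p j} := fun p => by
    rw [ofPred_forall]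
    exact MeasurableSet.iInter fun j => measurableSet_le (measurable_Uv hmeas 0 j) measurable_const
  refine ⟨fun p hp j s t hs hst ht => ?_, fun p _ j hj => ?_, fun j t ht => ?_⟩
  · have hsub : {ω | ∀ k, Uv P X 0 ω k ≤ Function.update p j s k} ⊆
        {ω | ∀ k, Uv P X 0 ω k ≤ Function.update p j t k} := fun ω hω k =>
      (hω k).trans (update_le_update_iff.2 ⟨hst, fun _ _ => le_rfl⟩ k)
    have hd := measureReal_sdiff (μ := P) hsub (hms _)
    have hd' := measureReal_sdiff (μ := P) (s₁ := {ω | Uv P X 0 ω j ≤ t})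
      (s₂ := {ω | Uv P X 0 ω j ≤ s}) (fun ω hω => le_trans hω hst)
      (measurableSet_le (measurable_Uv hmeas 0 j) measurable_const)
    rw [hU j t ⟨hs.trans hst, ht⟩, hU j s ⟨hs, hst.trans ht⟩] at hd'
    change 0 ≤ P.real _ - P.real _ ∧ P.real _ - P.real _ ≤ _
    rw [← hd, ← hd']
    refine ⟨measureReal_nonneg, measureReal_mono ?_⟩
    rintro ω ⟨h1, h2⟩
    refine ⟨by simpa using h1 j, fun h => h2 fun k => ?_⟩
    by_cases hk : k = j
    · subst hk; simpa using h
    · simpa [hk] using h1 k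
  · refine le_antisymm ?_ measureReal_nonneg
    rw [← hU j 0 ⟨le_rfl, zero_le_one⟩]
    exact measureReal_mono fun ω hω => by simpa [hj] using hω j
  · refine Eq.trans (b := P.real {ω | Uv P X 0 ω j ≤ t}) ?_ (hU j t ht)
    change P.real _ = P.real _
    congr 1
    ext ω
    refine ⟨fun h => by simpa using h j, fun h k => ?_⟩
    by_cases hk : k = j
    · subst hk; simpa using h
    · simpa [hk] using (Uv_mem_Icc 0 ω k).2

end Transform

lemma le_biSup_of_forall_le {α : Type*} {S : Set α} {f : α → ℝ} {B : ℝ} (hB : ∀ x ∈ S, f x ≤ B)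
    {x : α} (hx : x ∈ S) : f x ≤ ⨆ y ∈ S, f y := by
  refine le_ciSup_of_le (f := fun y => ⨆ _ : y ∈ S, f y) ⟨max B 0, ?_⟩ x ?_
  · rintro _ ⟨y, rfl⟩
    exact Real.iSup_le (fun hy => (hB y hy).trans (le_max_left _ _)) (le_max_right _ _)
  · simp [hx]

open Classical in
lemma sum_indic_eq_card {α : Type*} (I : Finset ℤ) (p : ℤ → α → Prop) (ω : α) :
    ∑ i ∈ I, indic {ω' | p i ω'} ω = ((I.filter fun i => p i ω).card : ℝ) := by
  simp [indic, Set.indicator_apply]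

lemma inv_mul_sum_indic_mem_Icc {α : Type*} (n : ℕ) (p : ℤ → α → Prop) (ω : α) :
    (n : ℝ)⁻¹ * ∑ i ∈ Finset.Icc (1 : ℤ) n, indic {ω' | p i ω'} ω ∈ Icc (0 : ℝ) 1 := by
  classical
  rw [sum_indic_eq_card]
  have h := Finset.card_filter_le (Finset.Icc (1 : ℤ) n) fun i => p i ω
  rw [Int.card_Icc] at h
  have h' : (((Finset.Icc (1 : ℤ) n).filter fun i => p i ω).card : ℝ) ≤ n := by
    exact_mod_cast h.trans (by simp)
  refine ⟨by positivity, ?_⟩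
  rw [inv_mul_eq_div]
  exact div_le_one_of_le₀ h' (Nat.cast_nonneg n)

lemma inv_mul_sum_indic_mono {α : Type*} (n : ℕ) {p q : ℤ → α → Prop} {ω : α}
    (h : ∀ i ∈ Finset.Icc (1 : ℤ) n, p i ω → q i ω) :
    (n : ℝ)⁻¹ * ∑ i ∈ Finset.Icc (1 : ℤ) n, indic {ω' | p i ω'} ω ≤
      (n : ℝ)⁻¹ * ∑ i ∈ Finset.Icc (1 : ℤ) n, indic {ω' | q i ω'} ω := by
  classical
  rw [sum_indic_eq_card, sum_indic_eq_card]
  gcongr with i hi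
  exact h i hi

lemma inv_mul_sum_indic_congr {α : Type*} (n : ℕ) {p q : ℤ → α → Prop} {ω : α}
    (h : ∀ i ∈ Finset.Icc (1 : ℤ) n, (p i ω ↔ q i ω)) :
    (n : ℝ)⁻¹ * ∑ i ∈ Finset.Icc (1 : ℤ) n, indic {ω' | p i ω'} ω =
      (n : ℝ)⁻¹ * ∑ i ∈ Finset.Icc (1 : ℤ) n, indic {ω' | q i ω'} ω :=
  le_antisymm (inv_mul_sum_indic_mono n fun i hi => (h i hi).1)
    (inv_mul_sum_indic_mono n fun i hi => (h i hi).2)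

lemma inv_mul_sum_indic_eq_zero {α : Type*} (n : ℕ) {p : ℤ → α → Prop} {ω : α}
    (h : ∀ i ∈ Finset.Icc (1 : ℤ) n, ¬ p i ω) :
    (n : ℝ)⁻¹ * ∑ i ∈ Finset.Icc (1 : ℤ) n, indic {ω' | p i ω'} ω = 0 := by
  rw [Finset.sum_eq_zero fun i hi => ?_, mul_zero]
  simp [indic, h i hi]

lemma inv_mul_sum_indic_eq_one {α : Type*} {n : ℕ} (hn : 0 < n) {p : ℤ → α → Prop} {ω : α}
    (h : ∀ i ∈ Finset.Icc (1 : ℤ) n, p i ω) :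
    (n : ℝ)⁻¹ * ∑ i ∈ Finset.Icc (1 : ℤ) n, indic {ω' | p i ω'} ω = 1 := by
  have hn' : (n : ℝ) ≠ 0 := by positivity
  rw [Finset.sum_congr rfl fun i hi => show _ = (1 : ℝ) by simp [indic, h i hi]]
  simp [hn']

section Path

variable {P : Measure Ω} {X : ℤ → Ω → Fin d → ℝ} {n : ℕ} {ω : Ω}

lemma Gn_update_one [IsProbabilityMeasure P] (j : Fin d) (t : ℝ) :
    Gn P X n (Function.update (fun _ => (1 : ℝ)) j t) ω = Gnj P X n j t ω := by
  refine inv_mul_sum_indic_congr (p := fun i ω' => ∀ k, Uv P X i ω' k ≤ _)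
    (q := fun i ω' => Uv P X i ω' j ≤ t) n fun i _ =>
      ⟨fun h => by simpa using h j, fun h k => ?_⟩
  by_cases hk : k = j
  · subst hk; simpa using h
  · simpa [hk] using (Uv_mem_Icc i ω k).2

lemma alphan_update_one [IsProbabilityMeasure P] (hC : IsCopula (cop P X)) (j : Fin d) {t : ℝ}
    (ht : t ∈ Icc (0 : ℝ) 1) :
    alphan P X n (Function.update (fun _ => (1 : ℝ)) j t) ω = alphanj P X n j t ω := by
  rw [alphan, Gn_update_one, hC.margin j t ht, alphanj]

lemma Gnj_mono (j : Fin d) : Monotone fun t => Gnj P X n j t ω := fun _ _ h =>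
  inv_mul_sum_indic_mono (p := fun i ω' => Uv P X i ω' j ≤ _)
    (q := fun i ω' => Uv P X i ω' j ≤ _) n fun _ _ hi => hi.trans h

lemma Gnj_mem_Icc (j : Fin d) (t : ℝ) : Gnj P X n j t ω ∈ Icc (0 : ℝ) 1 :=
  inv_mul_sum_indic_mem_Icc n (fun i ω' => Uv P X i ω' j ≤ t) ω

lemma abs_alphan_le [IsProbabilityMeasure P] (p : Fin d → ℝ) :
    |alphan P X n p ω| ≤ Real.sqrt n := by
  have h1 := inv_mul_sum_indic_mem_Icc n (fun i ω' => ∀ j, Uv P X i ω' j ≤ p j) ω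
  have h2 : cop P X p ∈ Icc (0 : ℝ) 1 := ⟨measureReal_nonneg, measureReal_le_one⟩
  rw [alphan, abs_mul, abs_of_nonneg (Real.sqrt_nonneg _)]
  refine mul_le_of_le_one_right (Real.sqrt_nonneg _) (abs_sub_le_iff.2 ?_)
  exact ⟨by linarith [h1.2, h2.1, show Gn P X n p ω ≤ 1 from h1.2],
    by linarith [h2.2, show 0 ≤ Gn P X n p ω from h1.1]⟩

lemma GoodPath.alphan_eq_zero (hω : GoodPath P X ω) (hC : IsCopula (cop P X)) {p : Fin d → ℝ}
    (hp : p ∈ Icc (0 : Fin d → ℝ) 1) {j : Fin d} (hj : p j = 0) : alphan P X n p ω = 0 := by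
  have : Gn P X n p ω = 0 :=
    inv_mul_sum_indic_eq_zero (p := fun i ω' => ∀ j, Uv P X i ω' j ≤ p j) n fun i _ h =>
      absurd (h j) (by rw [hj]; exact not_le.2 (hω.mem_Ioo i j).1)
  rw [alphan, this, hC.grounded p hp j hj]
  simp

/-- Near the endpoints the empirical c.d.f. is constant, so the deviation from uniformity
vanishes linearly there. -/
lemma GoodPath.exists_abs_Gnj_sub_le (hω : GoodPath P X ω) (hn : 0 < n) (j : Fin d) :
    ∃ L : ℝ, ∀ s ∈ Ioo (0 : ℝ) 1, |Gnj P X n j s ω - s| ≤ L * (s * (1 - s)) := by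
  obtain ⟨a, ha0, ha⟩ : ∃ a : ℝ, (0 < a ∧ a ≤ 1 / 2) ∧ ∀ i ∈ Finset.Icc (1 : ℤ) n,
      a < Uv P X i ω j ∧ Uv P X i ω j < 1 - a := by
    have h1 : ∀ᶠ a : ℝ in nhdsWithin 0 (Ioi 0), a ≤ 1 / 2 :=
      (eventually_le_nhds (by norm_num)).filter_mono nhdsWithin_le_nhds
    have h2 : ∀ᶠ a : ℝ in nhdsWithin 0 (Ioi 0), ∀ i ∈ Finset.Icc (1 : ℤ) n,
        a < Uv P X i ω j ∧ Uv P X i ω j < 1 - a := by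
      rw [Filter.eventually_all_finset]
      intro i _
      obtain ⟨h, h'⟩ := hω.mem_Ioo i j
      refine ((eventually_lt_nhds h).and ?_).filter_mono nhdsWithin_le_nhds
      filter_upwards [eventually_lt_nhds (show (0 : ℝ) < 1 - Uv P X i ω j by linarith)] with a ha
      linarith
    obtain ⟨a, ⟨h, h'⟩, h''⟩ := ((eventually_mem_nhdsWithin.and h1).and h2).exists
    exact ⟨a, ⟨h, h'⟩, h''⟩
  refine ⟨2 / a, fun s hs => ?_⟩
  have hs0 : 0 ≤ s * (1 - s) := mul_one_sub_nonneg ⟨hs.1.le, hs.2.le⟩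
  have hL : 2 * (s * (1 - s)) ≤ 2 / a * (s * (1 - s)) := by
    gcongr
    rw [le_div_iff₀ ha0.1]; linarith [ha0.2]
  rcases lt_or_ge s a with hsa | hsa
  · have h0 : Gnj P X n j s ω = 0 :=
      inv_mul_sum_indic_eq_zero (p := fun i ω' => Uv P X i ω' j ≤ s) n fun i hi h => by
        linarith [(ha i hi).1]
    rw [h0, zero_sub, abs_neg, abs_of_pos hs.1]
    nlinarith [hs.1]
  rcases lt_or_ge s (1 - a) with hsa' | hsa'
  · have h := Gnj_mem_Icc (P := P) (X := X) (n := n) (ω := ω) j s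
    calc |Gnj P X n j s ω - s| ≤ 1 := by
          rw [abs_le]; constructor <;> linarith [h.1, h.2, hs.1, hs.2]
      _ = 2 / a * (a / 2) := by have := ha0.1.ne'; field_simp
      _ ≤ 2 / a * (s * (1 - s)) := by
          refine mul_le_mul_of_nonneg_left ?_ (div_nonneg zero_le_two ha0.1.le)
          nlinarith [ha0.1, ha0.2]
  · have h0 : Gnj P X n j s ω = 1 :=
      inv_mul_sum_indic_eq_one (p := fun i ω' => Uv P X i ω' j ≤ s) hn fun i hi => by
        linarith [(ha i hi).2]
    rw [h0, abs_of_pos (by linarith [hs.2])]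
    nlinarith [hs.2]

lemma GoodPath.abs_alphanj_le (hω : GoodPath P X ω) (hn : 0 < n) {μ M : ℝ} (hμ0 : 0 < μ)
    (hμ1 : μ ≤ 1) (j : Fin d)
    (hM : (⨆ s ∈ Ioo (0 : ℝ) 1, |alphanj P X n j s ω| / (s * (1 - s)) ^ μ) ≤ M) {t : ℝ}
    (ht : t ∈ Icc (0 : ℝ) 1) : |alphanj P X n j t ω| ≤ M * (t * (1 - t)) ^ μ := by
  rcases ht.1.eq_or_lt with h0 | h0
  · have : Gnj P X n j t ω = 0 :=
      inv_mul_sum_indic_eq_zero (p := fun i ω' => Uv P X i ω' j ≤ t) n fun i _ h => by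
        linarith [(hω.mem_Ioo i j).1]
    rw [alphanj, this]; simp [← h0, Real.zero_rpow hμ0.ne']
  rcases ht.2.eq_or_lt with h1 | h1
  · have : Gnj P X n j t ω = 1 :=
      inv_mul_sum_indic_eq_one (p := fun i ω' => Uv P X i ω' j ≤ t) hn fun i _ => by
        linarith [(hω.mem_Ioo i j).2]
    rw [alphanj, this]; simp [h1, Real.zero_rpow hμ0.ne']
  obtain ⟨L, hL⟩ := hω.exists_abs_Gnj_sub_le hn j
  have hpos : ∀ s ∈ Ioo (0 : ℝ) 1, 0 < s * (1 - s) := fun s hs =>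
    mul_pos hs.1 (sub_pos.2 hs.2)
  have hbdd : ∀ s ∈ Ioo (0 : ℝ) 1,
      |alphanj P X n j s ω| / (s * (1 - s)) ^ μ ≤ Real.sqrt n * |L| := by
    intro s hs
    have hp := hpos s hs
    rw [div_le_iff₀ (Real.rpow_pos_of_pos hp _), alphanj, abs_mul,
      abs_of_nonneg (Real.sqrt_nonneg _), mul_assoc]
    gcongr
    have h1 : s * (1 - s) ≤ (s * (1 - s)) ^ μ := by
      conv_lhs => rw [← Real.rpow_one (s * (1 - s))]
      exact Real.rpow_le_rpow_of_exponent_ge hp (by nlinarith [hs.1, hs.2]) hμ1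
    calc _ ≤ L * (s * (1 - s)) := hL s hs
      _ ≤ |L| * (s * (1 - s)) := by gcongr; exact le_abs_self L
      _ ≤ _ := by gcongr
  have h := (le_biSup_of_forall_le hbdd (x := t) ⟨h0, h1⟩).trans hM
  rwa [div_le_iff₀ (Real.rpow_pos_of_pos (hpos t ⟨h0, h1⟩) _)] at h

lemma abs_alphan_sub_le_of_Mn [IsProbabilityMeasure P] (hn : 0 < n) {δ μ : ℝ} (hμ0 : 0 < μ)
    (hM : Mn P X n δ μ ω ≤ 1) {p q : Fin d → ℝ} (hp : p ∈ Icc (0 : Fin d → ℝ) 1)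
    (hq : q ∈ Icc (0 : Fin d → ℝ) 1) {x : ℝ} (hnx : (n : ℝ)⁻¹ ≤ x) (hxδ : x ≤ δ)
    (hpq : dist p q ≤ x) : |alphan P X n p ω - alphan P X n q ω| ≤ x ^ μ := by
  have hn' : (0 : ℝ) < n := by exact_mod_cast hn
  have hnμ : 0 < (n : ℝ) ^ (-μ) := Real.rpow_pos_of_pos hn' _
  have h := le_biSup_of_forall_le (B := 2 * Real.sqrt n / (n : ℝ) ^ (-μ))
    (S := {q : (Fin d → ℝ) × (Fin d → ℝ) |
      q.1 ∈ Icc 0 1 ∧ q.2 ∈ Icc 0 1 ∧ dist q.1 q.2 ≤ δ})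
    (f := fun q => |alphan P X n q.1 ω - alphan P X n q.2 ω| /
      max (dist q.1 q.2 ^ μ) ((n : ℝ) ^ (-μ))) (x := (p, q)) (fun r _ => by
        gcongr
        · have h1 := abs_sub (alphan P X n r.1 ω) (alphan P X n r.2 ω)
          have h2 := abs_alphan_le (P := P) (X := X) (n := n) (ω := ω) r.1
          have h3 := abs_alphan_le (P := P) (X := X) (n := n) (ω := ω) r.2
          linarith
        · exact le_max_right _ _) ⟨hp, hq, hpq.trans hxδ⟩
  have h := h.trans hM
  simp only [] at h
  rw [div_le_one (lt_max_of_lt_right hnμ)] at h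
  refine h.trans (max_le (Real.rpow_le_rpow dist_nonneg hpq hμ0.le) ?_)
  rw [Real.rpow_neg hn'.le, ← Real.inv_rpow hn'.le]
  exact Real.rpow_le_rpow (by positivity) hnx hμ0.le

lemma GoodPath.pseudoObs_eq (hω : GoodPath P X ω) [IsProbabilityMeasure P] (i : ℤ) (j : Fin d) :
    pseudoObs X n i ω j = (n : ℝ) / (n + 1) * Gnj P X n j (Uv P X i ω j) ω := by
  rw [pseudoObs]
  congr 1
  exact inv_mul_sum_indic_congr (p := fun k ω' => X k ω' j ≤ X i ω j)
    (q := fun k ω' => Uv P X k ω' j ≤ Uv P X i ω j) n fun k _ =>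
      ⟨fun h => margF_mono j h, fun h => hω.le_of_Uv_le k i j h⟩

/-- The thresholds on the pseudo-observations are thresholds on the `U_{ij}` at an approximate
empirical quantile. -/
lemma GoodPath.exists_quantile (hω : GoodPath P X ω) [IsProbabilityMeasure P] (hn : 0 < n)
    {ε : ℝ} (j : Fin d)
    (hosc : ∀ s ∈ Icc (0 : ℝ) 1, ∀ t ∈ Icc (0 : ℝ) 1, |s - t| ≤ (n : ℝ)⁻¹ →
      |alphanj P X n j s ω - alphanj P X n j t ω| ≤ ε)
    (hε : Real.sqrt n * (n : ℝ)⁻¹ ≤ ε) {u : ℝ} (hu : u ∈ Ioo (0 : ℝ) 1) :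
    ∃ v ∈ Icc (0 : ℝ) 1,
      (∀ i ∈ Finset.Icc (1 : ℤ) n, (pseudoObs X n i ω j ≤ u ↔ Uv P X i ω j ≤ v)) ∧
      |Real.sqrt n * (Gnj P X n j v ω - u)| ≤ 2 * ε := by
  classical
  have hn' : (0 : ℝ) < n := by exact_mod_cast hn
  have hε0 : 0 ≤ ε := le_trans (by positivity) hε
  have hr0 : 0 ≤ (n : ℝ) / (n + 1) := by positivity
  set I := Finset.Icc (1 : ℤ) n
  set φ : ℝ → ℝ := fun t => (n : ℝ) / (n + 1) * Gnj P X n j t ω with hφ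
  have hφmono : Monotone φ := fun s t h => mul_le_mul_of_nonneg_left (Gnj_mono j h) hr0
  obtain ⟨v, hv, hφv, hA⟩ : ∃ v ∈ Icc (0 : ℝ) 1, φ v ≤ u ∧
      ∀ i ∈ I, (φ (Uv P X i ω j) ≤ u ↔ Uv P X i ω j ≤ v) := by
    rcases (I.filter fun i => φ (Uv P X i ω j) ≤ u).eq_empty_or_nonempty with he | hne
    · have h0 : Gnj P X n j 0 ω = 0 :=
        inv_mul_sum_indic_eq_zero (p := fun i ω' => Uv P X i ω' j ≤ 0) n fun i _ h =>
          absurd h (not_le.2 (hω.mem_Ioo i j).1)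
      refine ⟨0, ⟨le_rfl, zero_le_one⟩, by simp [hφ, h0, hu.1.le], fun i hi =>
        ⟨fun h => ?_, fun h => absurd h (not_le.2 (hω.mem_Ioo i j).1)⟩⟩
      have : i ∈ I.filter fun i => φ (Uv P X i ω j) ≤ u := Finset.mem_filter.2 ⟨hi, h⟩
      simp [he] at this
    · obtain ⟨k, hk, hmax⟩ := Finset.exists_max_image _ (fun i => Uv P X i ω j) hne
      have hk' := (Finset.mem_filter.1 hk).2
      exact ⟨Uv P X k ω j, Uv_mem_Icc k ω j, hk', fun i hi =>
        ⟨fun h => hmax i (Finset.mem_filter.2 ⟨hi, h⟩), fun h => (hφmono h).trans hk'⟩⟩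
  refine ⟨v, hv, fun i hi => by rw [hω.pseudoObs_eq]; exact hA i hi, ?_⟩
  have hG := Gnj_mem_Icc (P := P) (X := X) (n := n) (ω := ω) j
  have hsq := Real.sqrt_nonneg (n : ℝ)
  rw [abs_le]
  constructor
  · rcases (I.filter fun i => ¬ φ (Uv P X i ω j) ≤ u).eq_empty_or_nonempty with he | hne
    · have h1 : Gnj P X n j v ω = 1 :=
        inv_mul_sum_indic_eq_one (p := fun i ω' => Uv P X i ω' j ≤ v) hn fun i hi =>
          (hA i hi).1 (by
            have := Finset.filter_eq_empty_iff.1 he hi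
            simpa using this)
      rw [h1]
      nlinarith [hu.2]
    · obtain ⟨k, hk, hmin⟩ := Finset.exists_min_image _ (fun i => Uv P X i ω j) hne
      obtain ⟨hkI, hk'⟩ := Finset.mem_filter.1 hk
      have hvk : v < Uv P X k ω j := not_le.1 fun h => hk' ((hA k hkI).2 h)
      set t := Uv P X k ω j with ht
      set s := max v (t - (n : ℝ)⁻¹) with hs
      have hst : s < t := max_lt hvk (by linarith [inv_pos.2 hn'])
      have hs1 : s ∈ Icc (0 : ℝ) 1 :=
        ⟨hv.1.trans (le_max_left _ _), hst.le.trans (Uv_mem_Icc k ω j).2⟩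
      have hts : t - s ≤ (n : ℝ)⁻¹ := by linarith [le_max_right v (t - (n : ℝ)⁻¹)]
      have hGs : Gnj P X n j s ω = Gnj P X n j v ω :=
        inv_mul_sum_indic_congr (p := fun i ω' => Uv P X i ω' j ≤ s)
          (q := fun i ω' => Uv P X i ω' j ≤ v) n fun i hi =>
            ⟨fun h => (hA i hi).1 (not_not.1 fun hc => absurd
              (hmin i (Finset.mem_filter.2 ⟨hi, hc⟩)) (not_le.2 (h.trans_lt hst))),
              fun h => h.trans (le_max_left _ _)⟩
      have h1 := hosc t (Uv_mem_Icc k ω j) s hs1 (by rwa [abs_of_pos (sub_pos.2 hst)])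
      have h2 := (abs_le.1 h1).2
      have h3 : u ≤ Gnj P X n j t ω := (not_le.1 hk').le.trans
        (mul_le_of_le_one_left (hG t).1 (div_le_one_of_le₀ (by linarith) (by positivity)))
      have h4 : Real.sqrt n * (t - s) ≤ ε := (by gcongr : _ ≤ _).trans hε
      have h5 : Real.sqrt n * u ≤ Real.sqrt n * Gnj P X n j t ω := by gcongr
      simp only [alphanj, hGs] at h2
      nlinarith
  · have h1 : Gnj P X n j v ω - u ≤ (n : ℝ)⁻¹ := by
      have : Gnj P X n j v ω - φ v ≤ (n : ℝ)⁻¹ := by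
        have e : Gnj P X n j v ω - φ v = Gnj P X n j v ω * (n + 1 : ℝ)⁻¹ := by
          simp only [hφ]; field_simp; ring
        rw [e]
        refine (mul_le_of_le_one_left (by positivity) (hG v).2).trans ?_
        gcongr
        linarith
      linarith
    have h2 : Real.sqrt n * (Gnj P X n j v ω - u) ≤ Real.sqrt n * (n : ℝ)⁻¹ := by gcongr
    linarith

end Path

lemma g1_cases {u : Fin d → ℝ} (hd : 2 ≤ d) {a : ℝ} (hu : ∀ j, a ≤ u j ∧ u j ≤ 1 - a) :
    a ≤ g1 u ∧ ((∃ j₁, u j₁ ≤ g1 u) ∨ ∃ j₀, ∀ k, k ≠ j₀ → 1 - u k ≤ g1 u) := by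
  have : Nontrivial (Fin d) := Fin.nontrivial_iff_two_le.2 hd
  have hne : ∀ j : Fin d, Nonempty {k : Fin d // k ≠ j} := fun j =>
    (exists_ne j).elim fun k hk => ⟨⟨k, hk⟩⟩
  have hbdd : ∀ j : Fin d, BddBelow (range fun k : {k : Fin d // k ≠ j} => u k) := fun j =>
    (finite_range _).bddBelow
  refine ⟨le_min (le_ciInf fun j => (hu j).1) (le_ciInf fun j => ?_), ?_⟩
  · obtain ⟨k⟩ := hne j
    linarith [ciInf_le (hbdd j) k, (hu k).2]
  · rcases min_choice (⨅ j, u j) (⨅ j : Fin d, (1 - ⨅ k : {k : Fin d // k ≠ j}, u (k : Fin d)))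
      with h | h
    · obtain ⟨j, hj⟩ := exists_eq_ciInf_of_finite (f := u)
      exact Or.inl ⟨j, by rw [g1, h, hj]⟩
    · obtain ⟨j, hj⟩ := exists_eq_ciInf_of_finite
        (f := fun j : Fin d => 1 - ⨅ k : {k : Fin d // k ≠ j}, u (k : Fin d))
      refine Or.inr ⟨j, fun k hk => ?_⟩
      rw [g1, h, ← hj]
      linarith [ciInf_le (hbdd j) ⟨k, hk⟩]

lemma linConst_nonneg (d : ℕ) {K M B : ℝ} (hK : 0 ≤ K) (hM : 0 ≤ M) (hB : 0 ≤ B) :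
    0 ≤ linConst d K M B := by
  unfold linConst
  positivity

section Path

variable {P : Measure Ω} {X : ℤ → Ω → Fin d → ℝ} {n : ℕ} {ω : Ω} [IsProbabilityMeasure P]

lemma GoodPath.regularPath (hω : GoodPath P X ω) (hC : IsCopula (cop P X)) (hn : 0 < n)
    {μ M τ δ : ℝ} (hμ0 : 0 < μ) (hμ1 : μ ≤ 1) (hτ : (n : ℝ)⁻¹ ≤ τ)
    (hsup : ∀ j, (⨆ s ∈ Ioo (0 : ℝ) 1, |alphanj P X n j s ω| / (s * (1 - s)) ^ μ) ≤ M)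
    (hMn : Mn P X n δ μ ω ≤ 1) : RegularPath (fun p => alphan P X n p ω) μ M τ δ where
  weighted j t ht := by
    rw [alphan_update_one hC j ht]
    exact hω.abs_alphanj_le hn hμ0 hμ1 j (hsup j) ht
  grounded _ hp _ hj := hω.alphan_eq_zero hC hp hj
  modulus _ hp _ hq _ hτx hxδ hpq :=
    abs_alphan_sub_le_of_Mn hn hμ0 hMn hp hq (hτ.trans hτx) hxδ hpq

/-- The empirical copula at `u` is the empirical c.d.f. at a random quantile point `v`, so its
distance to the linearized process is a linearization error. -/
lemma GoodPath.exists_quantilePoint (hω : GoodPath P X ω) (hC : IsCopula (cop P X)) (hn : 0 < n)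
    {μ M τ δ : ℝ} (hμ0 : 0 < μ) (hμ : μ ≤ 1 / 2) (hM : 1 ≤ M) (hτ : (n : ℝ)⁻¹ ≤ τ)
    (hτ1 : τ ≤ 1) (hτδ : τ ≤ δ) (hsτ : Real.sqrt n * τ ^ (1 - μ) = 1)
    (hα : RegularPath (fun p => alphan P X n p ω) μ M τ δ) {u : Fin d → ℝ}
    (hu : ∀ j, u j ∈ Ioo (0 : ℝ) 1) :
    ∃ v, QuantilePoint (fun p => alphan P X n p ω) μ (Real.sqrt n) τ (M * (4 + 4 * M ^ 2) + 2) u v ∧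
      hatCP P X n u ω - Cbar P X n u ω =
        linError (cop P X) (fun p => alphan P X n p ω) (Real.sqrt n) u v := by
  have hn' : (0 : ℝ) < n := by exact_mod_cast hn
  have hτ0 : 0 < τ := (inv_pos.2 hn').trans_le hτ
  have hsq : 0 < Real.sqrt n := Real.sqrt_pos.2 hn'
  have hone : (fun _ => (1 : ℝ)) ∈ Icc (0 : Fin d → ℝ) 1 := ⟨fun _ => zero_le_one, le_rfl⟩
  have hε : Real.sqrt n * (n : ℝ)⁻¹ ≤ τ ^ μ := by
    have h1 : Real.sqrt n * (n : ℝ)⁻¹ = τ ^ (1 - μ) := by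
      have := Real.mul_self_sqrt hn'.le
      calc Real.sqrt n * (n : ℝ)⁻¹ = Real.sqrt n * (n : ℝ)⁻¹ * (Real.sqrt n * τ ^ (1 - μ)) := by
            rw [hsτ, mul_one]
        _ = (Real.sqrt n * Real.sqrt n) * (n : ℝ)⁻¹ * τ ^ (1 - μ) := by ring
        _ = _ := by rw [this]; field_simp
    rw [h1]
    exact Real.rpow_le_rpow_of_exponent_ge hτ0 hτ1 (by linarith)
  have hosc : ∀ j, ∀ s ∈ Icc (0 : ℝ) 1, ∀ t ∈ Icc (0 : ℝ) 1, |s - t| ≤ (n : ℝ)⁻¹ →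
      |alphanj P X n j s ω - alphanj P X n j t ω| ≤ τ ^ μ := by
    intro j s hs t ht hst
    rw [← alphan_update_one hC j hs, ← alphan_update_one hC j ht]
    refine hα.modulus _ (update_mem_cube hone hs j) _ (update_mem_cube hone ht j) τ le_rfl hτδ ?_
    refine (dist_pi_le_iff hτ0.le).2 fun k => ?_
    by_cases hk : k = j
    · subst hk; simpa [Real.dist_eq] using hst.trans hτ
    · simpa [hk] using hτ0.le
  choose v hv hobs hquant using fun j => hω.exists_quantile hn j (hosc j) hε (hu j)
  have heq : ∀ j, Real.sqrt n * (v j - u j) + alphan P X n (Function.update (fun _ => 1) j (v j)) ω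
      = Real.sqrt n * (Gnj P X n j (v j) ω - u j) := fun j => by
    rw [alphan_update_one hC j (hv j), alphanj]; ring
  refine ⟨v, ⟨hu, ⟨fun j => (hv j).1, fun j => (hv j).2⟩, fun j => ?_, fun j => ?_⟩, ?_⟩
  · simp only [heq]
    exact hquant j
  · refine quantile_deviation_le hμ0 hμ hM hτ0 hsτ ⟨(hu j).1.le, (hu j).2.le⟩ (hv j) ?_
    have h1 := hα.weighted j (v j) (hv j)
    have h2 := hquant j
    rw [← heq] at h2
    calc Real.sqrt n * |v j - u j| = |Real.sqrt n * (v j - u j)| := by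
          rw [abs_mul, abs_of_pos hsq]
      _ ≤ |alphan P X n (Function.update (fun _ => 1) j (v j)) ω| +
          |Real.sqrt n * (v j - u j) + alphan P X n (Function.update (fun _ => 1) j (v j)) ω| := by
          have := abs_sub (Real.sqrt n * (v j - u j) +
            alphan P X n (Function.update (fun _ => 1) j (v j)) ω)
            (alphan P X n (Function.update (fun _ => 1) j (v j)) ω)
          rw [add_sub_cancel_right] at this
          linarith
      _ ≤ _ := add_le_add h1 h2
  · have hemp : empCop X n u ω = Gn P X n v ω :=
      inv_mul_sum_indic_congr (p := fun i ω' => ∀ j, pseudoObs X n i ω' j ≤ u j)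
        (q := fun i ω' => ∀ j, Uv P X i ω' j ≤ v j) n fun i hi => forall_congr' fun j => hobs j i hi
    rw [hatCP, hemp, linError, Cbar]
    simp only [alphan]
    ring

/-- Pathwise bound for the weighted approximation error. -/
lemma GoodPath.abs_weighted_sub_le (hω : GoodPath P X ω) (hC : IsCopula (cop P X))
    (h21 : Condition21 (cop P X)) (hd : 2 ≤ d) (hn : 0 < n) {K μ M B τ δ a w : ℝ} (hK : 0 < K)
    (hlip : ∀ j : Fin d, ∀ p ∈ VV d j, ∀ q ∈ VV d j, ∀ m : ℝ,
      m ≤ p j * (1 - p j) → m ≤ q j * (1 - q j) →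
      m * |Cdot (cop P X) j p - Cdot (cop P X) j q| ≤ K * ∑ k, |p k - q k|)
    (hw : 0 < w) (hwμ : w < μ) (hμ : μ ≤ 1 / 2) (hM : 1 ≤ M)
    (hBM : B = M * (4 + 4 * M ^ 2) + 2) (hτ : (n : ℝ)⁻¹ ≤ τ) (hτρ : τ ≤ 1 / Real.sqrt n)
    (hsτ : Real.sqrt n * τ ^ (1 - μ) = 1) (hδ : (2 * B + 1) * (2 * (1 / Real.sqrt n)) ≤ δ)
    (hα : RegularPath (fun p => alphan P X n p ω) μ M τ δ) (ha : 0 < a)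
    {u : Fin d → ℝ} (hu : ∀ j, a ≤ u j ∧ u j ≤ 1 - a) :
    |hatCP P X n u ω / gW w u - Cbar P X n u ω / gW w u| ≤
      linConst d K M B * ((1 / Real.sqrt n) ^ (μ - w) + τ ^ μ / a ^ w) := by
  have hn' : (0 : ℝ) < n := by exact_mod_cast hn
  have hτ0 : 0 < τ := (inv_pos.2 hn').trans_le hτ
  have hsq : 0 < Real.sqrt n := Real.sqrt_pos.2 hn'
  have hsq1 : 1 ≤ Real.sqrt n := Real.one_le_sqrt.2 (by exact_mod_cast hn)
  have hμ0 : 0 < μ := hw.trans hwμ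
  have hB : 0 ≤ B := by rw [hBM]; positivity
  set ρ := 1 / Real.sqrt n with hρ
  have hρ0 : 0 < ρ := by positivity
  have hρ1 : ρ ≤ 1 := by rw [hρ, div_le_one hsq]; exact hsq1
  have hxδ : ∀ x, x ≤ 2 * ρ → (2 * B + 1) * x ≤ δ := fun x hx =>
    (mul_le_mul_of_nonneg_left hx (by linarith)).trans hδ
  have hτδ : τ ≤ δ := by
    have := hxδ (2 * ρ) le_rfl
    nlinarith [mul_nonneg hB hρ0.le]
  obtain ⟨hγa, hcases⟩ := g1_cases hd hu
  set γ := g1 u with hγ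
  have hγ0 : 0 < γ := ha.trans_le hγa
  have hγw : 0 < γ ^ w := Real.rpow_pos_of_pos hγ0 _
  have hLC := linConst_nonneg d hK.le (zero_le_one.trans hM) hB
  obtain ⟨v, hq, hlin⟩ := hω.exists_quantilePoint hC hn hμ0 hμ hM hτ (hτρ.trans hρ1) hτδ hsτ hα
    (u := u) fun j => ⟨ha.trans_le (hu j).1, by linarith [(hu j).2]⟩
  rw [← hBM] at hq
  have hmain : ∀ x, τ ≤ x → x ≤ 2 * ρ →
      ((∃ j₁, u j₁ ≤ x) ∨ (∃ j₀, ∀ k, k ≠ j₀ → 1 - u k ≤ x) ∨ x = 1 / Real.sqrt n) →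
      |hatCP P X n u ω - Cbar P X n u ω| ≤ linConst d K M B * x ^ μ := fun x hτx hxρ hc =>
    hlin ▸ abs_linError_le_of_cases hC h21 hK hlip hα hμ0 (by linarith) (by linarith) hsq hτ0
      (hτρ.trans hρ1) hsτ hB hτx (hxδ x hxρ) hq hc
  rw [← sub_div, abs_div, gW, ← hγ, abs_of_pos hγw, div_le_iff₀ hγw, mul_assoc]
  have hτ' : 0 ≤ τ ^ μ / a ^ w * γ ^ w := by positivity
  have hρ' : 0 ≤ ρ ^ (μ - w) := Real.rpow_nonneg hρ0.le _
  rcases le_or_gt γ ρ with hγρ | hγρ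
  · refine (hmain (γ + τ) (by linarith) (by linarith) ?_).trans ?_
    · rcases hcases with ⟨j, hj⟩ | ⟨j, hj⟩
      · exact Or.inl ⟨j, by linarith⟩
      · exact Or.inr (Or.inl ⟨j, fun k hk => by linarith [hj k hk]⟩)
    · gcongr
      refine (Real.rpow_add_le_add_rpow hγ0.le hτ0.le hμ0.le (by linarith)).trans ?_
      rw [add_mul]
      refine add_le_add ?_ ?_
      · calc γ ^ μ = γ ^ (μ - w) * γ ^ w := by rw [← Real.rpow_add hγ0]; congr 1; ring
          _ ≤ _ := by gcongr
      · rw [div_mul_eq_mul_div, le_div_iff₀ (Real.rpow_pos_of_pos ha _)]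
        gcongr
  · refine (hmain ρ hτρ (by linarith) (Or.inr (Or.inr hρ))).trans ?_
    gcongr
    calc ρ ^ μ = ρ ^ (μ - w) * ρ ^ w := by rw [← Real.rpow_add hρ0]; congr 1; ring
      _ ≤ ρ ^ (μ - w) * γ ^ w := by gcongr
      _ ≤ _ := by rw [add_mul]; linarith

end Path

lemma exponent_lt_of_lt {w θ : ℝ} (hw : 0 < w) (hθ : θ < 1) (h : w < θ / (2 * (1 - θ))) :
    2 * w / (1 + 2 * w) < θ := by
  rw [lt_div_iff₀ (by linarith)] at h
  rw [div_lt_iff₀ (by positivity)]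
  linarith

lemma inv_le_rate {n : ℕ} (hn : 0 < n) {μ : ℝ} (hμ : μ ≤ 1 / 2) :
    (n : ℝ)⁻¹ ≤ (n : ℝ) ^ (-(1 / (2 * (1 - μ)))) := by
  rw [← Real.rpow_neg_one]
  refine Real.rpow_le_rpow_of_exponent_le (by exact_mod_cast hn) (neg_le_neg ?_)
  rw [div_le_one (by linarith)]
  linarith

lemma rate_le_one_div_sqrt {n : ℕ} (hn : 0 < n) {μ : ℝ} (hμ0 : 0 ≤ μ) (hμ : μ < 1 / 2) :
    (n : ℝ) ^ (-(1 / (2 * (1 - μ)))) ≤ 1 / Real.sqrt n := by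
  rw [Real.sqrt_eq_rpow, one_div (_ ^ _ : ℝ), ← Real.rpow_neg (Nat.cast_nonneg n)]
  refine Real.rpow_le_rpow_of_exponent_le (by exact_mod_cast hn) (neg_le_neg ?_)
  exact one_div_le_one_div_of_le (by linarith) (by linarith)

lemma sqrt_mul_rate {n : ℕ} (hn : 0 < n) {μ : ℝ} (hμ : μ < 1 / 2) :
    Real.sqrt n * ((n : ℝ) ^ (-(1 / (2 * (1 - μ))))) ^ (1 - μ) = 1 := by
  have hn' : (0 : ℝ) < n := by exact_mod_cast hn
  have hμ' : 1 - μ ≠ 0 := by linarith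
  rw [Real.sqrt_eq_rpow, ← Real.rpow_mul hn'.le, ← Real.rpow_add hn']
  convert Real.rpow_zero (n : ℝ) using 2
  field_simp
  ring

lemma eventually_mul_one_div_sqrt_le (b : ℝ) :
    ∀ᶠ n : ℕ in atTop, b * (1 / Real.sqrt n) ≤ (n : ℝ) ^ (-(1 / 4) : ℝ) := by
  have hδ : Tendsto (fun n : ℕ => b * (n : ℝ) ^ (-(1 / 4) : ℝ)) atTop (nhds (b * 0)) :=
    ((tendsto_rpow_neg_atTop (by norm_num)).comp tendsto_natCast_atTop_atTop).const_mul b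
  rw [mul_zero] at hδ
  filter_upwards [hδ.eventually_le_const one_pos, eventually_gt_atTop 0] with n h hn
  have hn' : (0 : ℝ) < n := by exact_mod_cast hn
  calc b * (1 / Real.sqrt n) = b * (n : ℝ) ^ (-(1 / 4) : ℝ) * (n : ℝ) ^ (-(1 / 4) : ℝ) := by
        rw [mul_assoc, ← Real.rpow_add hn', Real.sqrt_eq_rpow, one_div,
          ← Real.rpow_neg hn'.le]
        norm_num
    _ ≤ 1 * (n : ℝ) ^ (-(1 / 4) : ℝ) := by gcongr
    _ = _ := one_mul _

lemma tendsto_rate {w μ c : ℝ} (hw : 0 < w) (hμ : μ < 1 / 2) (hwμ : w * (2 * (1 - μ)) < μ)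
    (hc : 0 < c) :
    Tendsto (fun n : ℕ => (1 / Real.sqrt n) ^ (μ - w) +
      ((n : ℝ) ^ (-(1 / (2 * (1 - μ))))) ^ μ / (c / n) ^ w) atTop (nhds 0) := by
  have h1 : Tendsto (fun n : ℕ => (n : ℝ) ^ (-((μ - w) / 2))) atTop (nhds 0) :=
    (tendsto_rpow_neg_atTop (by nlinarith)).comp tendsto_natCast_atTop_atTop
  have h2 : Tendsto (fun n : ℕ => (c ^ w)⁻¹ * (n : ℝ) ^ (-(μ / (2 * (1 - μ)) - w))) atTop
      (nhds ((c ^ w)⁻¹ * 0)) :=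
    ((tendsto_rpow_neg_atTop (by
      rw [sub_pos, lt_div_iff₀ (by linarith)]; exact hwμ)).comp
        tendsto_natCast_atTop_atTop).const_mul _
  rw [mul_zero] at h2
  have h := h1.add h2
  rw [add_zero] at h
  refine h.congr' ?_
  filter_upwards [eventually_gt_atTop 0] with n hn
  have hn' : (0 : ℝ) < n := by exact_mod_cast hn
  congr 1
  · rw [Real.sqrt_eq_rpow, one_div, ← Real.rpow_neg hn'.le, ← Real.rpow_mul hn'.le]
    congr 1
    ring
  · rw [← Real.rpow_mul hn'.le, Real.div_rpow hc.le hn'.le, div_div_eq_mul_div,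
      ← Real.rpow_add hn', inv_mul_eq_div]
    congr 2
    ring

/-- Theorem 4.5, first part: weighted approximation of the empirical copula process
under the abstract Conditions 2.1, 4.1 and 4.3. -/
theorem weighted_approximation_empirical_copula
    {Ω : Type*} [MeasurableSpace Ω] {d : ℕ} (hd : 2 ≤ d)
    (P : Measure Ω) [IsProbabilityMeasure P] (X : ℤ → Ω → Fin d → ℝ)
    (hmeas : ∀ i, Measurable (X i)) (hstat : StrictlyStationary P X)
    (hcont : ∀ j, Continuous (margF P X j))
    (θ₁ θ₂ θ₃ : ℝ) (hθ₁ : θ₁ ∈ Set.Ioc (0 : ℝ) (1/2)) (hθ₂ : θ₂ ∈ Set.Ioc (0 : ℝ) (1/2))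
    (hθ₃ : θ₃ ∈ Set.Ioc (1/2 : ℝ) 1)
    (hC : Condition21 (cop P X)) (h41 : Condition41 P X θ₁) (h43 : Condition43 P X θ₂ θ₃) :
    ∀ c ∈ Set.Ioo (0 : ℝ) 1, ∀ w ∈ Set.Ioo (0 : ℝ) (min (θ₁ / (2 * (1 - θ₁))) (min (θ₂ / (2 * (1 - θ₂))) (θ₃ - 1/2))),
      oP1 P (fun n ω =>
        ⨆ u ∈ {u : Fin d → ℝ | ∀ j, c / n ≤ u j ∧ u j ≤ 1 - c / n},
          |hatCP P X n u ω / gW w u - Cbar P X n u ω / gW w u|) := by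
  intro c hc w hw ε hε
  obtain ⟨hw0, hw'⟩ := hw
  obtain ⟨hw1, hw2⟩ := lt_min_iff.1 hw'
  obtain ⟨μ, hwμ', hμθ⟩ := exists_between (lt_min
    (exponent_lt_of_lt hw0 (by linarith [hθ₁.2]) hw1)
    (exponent_lt_of_lt hw0 (by linarith [hθ₂.2]) (lt_min_iff.1 hw2).1))
  obtain ⟨hμ1, hμ2⟩ := lt_min_iff.1 hμθ
  have hμ0 : 0 < μ := (by positivity : 0 < 2 * w / (1 + 2 * w)).trans hwμ'
  have hμ : μ < 1 / 2 := hμ1.trans_le hθ₁.2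
  have hwμ : w * (2 * (1 - μ)) < μ := by
    rw [div_lt_iff₀ (by positivity)] at hwμ'
    linarith
  have hcop := isCopula_cop hmeas hstat hcont
  obtain ⟨K, hK, hlip⟩ := exists_Cdot_lipschitz hC
  set δ : ℕ → ℝ := fun n => (n : ℝ) ^ (-(1 / 4) : ℝ)
  have hδ : Tendsto δ atTop (nhds 0) :=
    (tendsto_rpow_neg_atTop (by norm_num)).comp tendsto_natCast_atTop_atTop
  rw [ENNReal.tendsto_nhds_zero]
  intro η hη
  obtain ⟨r, hr0, hrη⟩ : ∃ r : ℝ, 0 < r ∧ ENNReal.ofReal r ≤ η := by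
    obtain ⟨r, h1, h2⟩ := ENNReal.lt_iff_exists_nnreal_btwn.1 hη
    exact ⟨r, by simpa using h1, by simpa using h2.le⟩
  have hr' : 0 < r / (d + 1) := by positivity
  choose M' hM' using fun j => (h43 μ ⟨hμ0, hμ2⟩ (1 / 2) ⟨by norm_num, hθ₃.1⟩ j).1 _ hr'
  set M : ℝ := 1 + ∑ j, |M' j| with hMdef
  have hM : 1 ≤ M := le_add_of_nonneg_right (Finset.sum_nonneg fun j _ => abs_nonneg _)
  have hM'M : ∀ j, M' j ≤ M := fun j => by
    have := Finset.single_le_sum (f := fun j => |M' j|) (fun j _ => abs_nonneg _)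
      (Finset.mem_univ j)
    linarith [le_abs_self (M' j)]
  set B : ℝ := M * (4 + 4 * M ^ 2) + 2 with hB
  have hMn := ENNReal.tendsto_nhds_zero.1 (h41 μ ⟨hμ0, hμ1⟩ δ hδ 1 one_pos) _
    (ENNReal.ofReal_pos.2 hr')
  have hrate := (((tendsto_rate hw0 hμ hwμ hc.1).const_mul
    (linConst d K M B)).eventually_le_const (by simpa using hε))
  filter_upwards [eventually_gt_atTop 0, eventually_all.2 hM', hMn, hrate,
    eventually_mul_one_div_sqrt_le ((2 * B + 1) * 2)] with n hn hb hmn hbound hscale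
  have hsub : {ω | ε * 1 < |(⨆ u ∈ {u : Fin d → ℝ | ∀ j, c / n ≤ u j ∧ u j ≤ 1 - c / n},
      |hatCP P X n u ω / gW w u - Cbar P X n u ω / gW w u|)|} ⊆
      ({ω | ¬ GoodPath P X ω} ∪ ⋃ j, {ω | M' j < |⨆ s ∈ Set.Ioo (0 : ℝ) 1,
        |alphanj P X n j s ω| / (s * (1 - s)) ^ μ|}) ∪
        {ω | 1 * 1 < |Mn P X n (δ n) μ ω|} := by
    intro ω hω
    by_contra hcon
    simp only [mem_union, mem_iUnion, mem_ofPred_eq, not_or, not_exists, not_not, not_lt,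
      mul_one] at hcon hω
    obtain ⟨⟨hgood, hsup⟩, hmod⟩ := hcon
    have hα := hgood.regularPath hcop hn hμ0 (by linarith) (inv_le_rate hn hμ.le)
      (fun j => (le_abs_self _).trans ((hsup j).trans (hM'M j))) ((le_abs_self _).trans hmod)
    refine absurd hω (not_lt.2 ?_)
    rw [abs_of_nonneg (Real.iSup_nonneg fun u => Real.iSup_nonneg fun _ => abs_nonneg _)]
    refine Real.iSup_le (fun u => Real.iSup_le (fun hu => ?_) hε.le) hε.le
    exact (hgood.abs_weighted_sub_le hcop hC hd hn hK hlip hw0 (by nlinarith) hμ.le hM hB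
      (inv_le_rate hn hμ.le) (rate_le_one_div_sqrt hn hμ0.le hμ) (sqrt_mul_rate hn hμ)
      (by rw [← mul_assoc]; exact hscale) hα (div_pos hc.1 (by exact_mod_cast hn)) hu).trans hbound
  calc _ ≤ P (({ω | ¬ GoodPath P X ω} ∪ ⋃ j, {ω | M' j < |⨆ s ∈ Set.Ioo (0 : ℝ) 1,
        |alphanj P X n j s ω| / (s * (1 - s)) ^ μ|}) ∪
        {ω | 1 * 1 < |Mn P X n (δ n) μ ω|}) := measure_mono hsub
    _ ≤ (P {ω | ¬ GoodPath P X ω} + ∑ j, P {ω | M' j < |⨆ s ∈ Set.Ioo (0 : ℝ) 1,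
        |alphanj P X n j s ω| / (s * (1 - s)) ^ μ|}) +
        P {ω | 1 * 1 < |Mn P X n (δ n) μ ω|} :=
      (measure_union_le _ _).trans (add_le_add_left ((measure_union_le _ _).trans
        (add_le_add_right (measure_iUnion_fintype_le _ _) _)) _)
    _ ≤ (0 + ∑ _j : Fin d, ENNReal.ofReal (r / (d + 1))) + ENNReal.ofReal (r / (d + 1)) := by
      gcongr with j
      · exact (ae_iff.1 (ae_goodPath hmeas hstat hcont)).le
      · exact hb j
    _ = ENNReal.ofReal r := by
      rw [zero_add, ← ENNReal.ofReal_sum_of_nonneg fun _ _ => hr'.le,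
        ← ENNReal.ofReal_add (Finset.sum_nonneg fun _ _ => hr'.le) hr'.le]
      congr 1
      simp only [Finset.sum_const, Finset.card_univ, Fintype.card_fin, nsmul_eq_mul]
      field_simp
    _ ≤ η := hrη

end BBV
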